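/- arXiv:2503.19710 — 2 statements merged into one kernel-verified Lean document; each statement's English description precedes it below -/
import Mathlib

section
/- Let d ≥ 1, let Γ be a d×d symmetric positive definite real matrix, and let R be a d×d nonsingular M-matrix. Suppose that for each r ∈ (0,1) the Borel probability measures π^r, ν_1^r, …, ν_d^r on ℝ₊^d satisfy the basic adjoint relationship. Then there exists r₀ ∈ (0,1] such that for every k ∈ {1,…,d} and every integer n ≥ 0 there are finite constants C_{k,n} and C_{i,k,n} (i = 1,…,d) with: ∫(r^k z_k)^n dπ^r(z) < C_{k,n} and r^{i−1} ∫(r^k z_k)^n dν_i^r(z) < C_{i,k,n} for all i ∈ {1,…,d} and all r ∈ (0, r₀). In particular, the uniform moment bound condition holds for the families (π^r) and (ν_i^r). -/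
open MeasureTheory Filter

noncomputable section

namespace SRBMPaper

/-- The nonnegative orthant `ℝ₊^d`. -/
def posOrthant (d : ℕ) : Set (Fin d → ℝ) := {z | ∀ i, 0 ≤ z i}

/-- `R` is a P-matrix: every principal minor is positive. -/
def IsPMatrix {d : ℕ} (R : Matrix (Fin d) (Fin d) ℝ) : Prop :=
  ∀ s : Finset (Fin d),
    0 < (R.submatrix (fun i : s => (i : Fin d)) (fun i : s => (i : Fin d))).det

/-- `R` is a nonsingular M-matrix: nonpositive off-diagonal entries and
every principal minor positive. -/
def IsMMatrix {d : ℕ} (R : Matrix (Fin d) (Fin d) ℝ) : Prop :=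
  (∀ i j, i ≠ j → R i j ≤ 0) ∧ IsPMatrix R

/-- First-order partial derivative of `f` in coordinate `j`. -/
def pd1 {d : ℕ} (f : (Fin d → ℝ) → ℝ) (j : Fin d) (z : Fin d → ℝ) : ℝ :=
  fderiv ℝ f z (Pi.single j 1)

/-- Second-order partial derivative of `f` in coordinates `i`, `j`. -/
def pd2 {d : ℕ} (f : (Fin d → ℝ) → ℝ) (i j : Fin d) (z : Fin d → ℝ) : ℝ :=
  fderiv ℝ (fun w => pd1 f j w) z (Pi.single i 1)

/-- `f` is twice continuously differentiable and `f` together with all of its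
first- and second-order partial derivatives is bounded on the orthant. -/
def IsC2Bounded {d : ℕ} (f : (Fin d → ℝ) → ℝ) : Prop :=
  ContDiff ℝ 2 f ∧
    ∃ C : ℝ, ∀ z ∈ posOrthant d,
      |f z| ≤ C ∧ (∀ j, |pd1 f j z| ≤ C) ∧ (∀ i j, |pd2 f i j z| ≤ C)

/-- The basic adjoint relationship (BAR) at traffic-intensity parameter `r`. -/
def SatisfiesBAR {d : ℕ} (Γ R : Matrix (Fin d) (Fin d) ℝ) (r : ℝ)
    (π : Measure (Fin d → ℝ)) (ν : Fin d → Measure (Fin d → ℝ)) : Prop :=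
  ∀ f : (Fin d → ℝ) → ℝ, IsC2Bounded f →
    (1 / 2) * (∫ z, ∑ i, ∑ j, Γ i j * pd2 f i j z ∂π)
      - (∑ i : Fin d, r ^ ((i : ℕ) + 1) * ∫ z, ∑ j, R j i * pd1 f j z ∂π)
      + (∑ i : Fin d, r ^ ((i : ℕ) + 1) * ∫ z, ∑ j, R j i * pd1 f j z ∂(ν i)) = 0

/-- For every `r ∈ (0,1)`, `π r` is a Borel probability measure on the orthant,
each `ν i r` is a Borel probability measure on the face `{z i = 0}` of the orthant,
and together they satisfy the basic adjoint relationship. -/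
def BARFamily {d : ℕ} (Γ R : Matrix (Fin d) (Fin d) ℝ)
    (π : ℝ → Measure (Fin d → ℝ)) (ν : Fin d → ℝ → Measure (Fin d → ℝ)) : Prop :=
  ∀ r ∈ Set.Ioo (0 : ℝ) 1,
    IsProbabilityMeasure (π r) ∧ π r (posOrthant d) = 1 ∧
    (∀ i, IsProbabilityMeasure (ν i r) ∧
      ν i r {z | z ∈ posOrthant d ∧ z i = 0} = 1) ∧
    SatisfiesBAR Γ R r (π r) (fun i => ν i r)

/-- `u` is the vector `u_k` associated with the matrix `R`:
`u_k = (w_{1k}, …, w_{k-1,k}, 1, 0, …, 0)ᵀ` where the weights solve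
`∑_{j<k} w_{jk} R_{jℓ} + R_{kℓ} = 0` for all `ℓ < k`. -/
def IsUk {d : ℕ} (R : Matrix (Fin d) (Fin d) ℝ) (k : Fin d) (u : Fin d → ℝ) : Prop :=
  u k = 1 ∧ (∀ j, k < j → u j = 0) ∧
    ∀ ℓ, ℓ < k →
      (∑ j ∈ Finset.univ.filter (fun j => j < k), u j * R j ℓ) + R k ℓ = 0

/-- `uᵀ R_{:,i}`, the pairing of `u` with the `i`-th column of `R`. -/
def uR {d : ℕ} (R : Matrix (Fin d) (Fin d) ℝ) (u : Fin d → ℝ) (i : Fin d) : ℝ :=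
  ∑ j, u j * R j i

/-- The quadratic form `uᵀ Γ u`. -/
def quadForm {d : ℕ} (Γ : Matrix (Fin d) (Fin d) ℝ) (u : Fin d → ℝ) : ℝ :=
  ∑ i, ∑ j, u i * Γ i j * u j

/-- The limiting mean `m_k = (u_kᵀ Γ u_k) / (2 u_kᵀ R_{:,k})`. -/
def meanOf {d : ℕ} (Γ R : Matrix (Fin d) (Fin d) ℝ) (u : Fin d → ℝ) (k : Fin d) : ℝ :=
  quadForm Γ u / (2 * uR R u k)

/-- The exponential distribution on `ℝ` with mean `m`. -/
def expMean (m : ℝ) : Measure ℝ :=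
  (volume : Measure ℝ).withDensity fun x =>
    ENNReal.ofReal (if 0 ≤ x then m⁻¹ * Real.exp (-x / m) else 0)

/-- The law of a vector of independent exponential random variables with means `m k`. -/
def prodExp {d : ℕ} (m : Fin d → ℝ) : Measure (Fin d → ℝ) :=
  Measure.pi fun k => expMean (m k)

/-- The pushforwards of `π r` under `z ↦ (r z_1, r² z_2, …, r^d z_d)` converge weakly
to `μ` as `r → 0` (convergence tested against bounded continuous functions). -/
def ScaledWeakLimit {d : ℕ} (π : ℝ → Measure (Fin d → ℝ)) (μ : Measure (Fin d → ℝ)) : Prop :=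
  ∀ g : BoundedContinuousFunction (Fin d → ℝ) ℝ,
    Tendsto (fun r : ℝ => ∫ z, g (fun i => r ^ ((i : ℕ) + 1) * z i) ∂(π r))
      (nhdsWithin 0 (Set.Ioo 0 1)) (nhds (∫ z, g z ∂μ))

/-- The uniform moment bound condition: for all coordinates `i, k`, the `d`-th moment
of `r^k Z_k` under `π r` is bounded for small `r`, and `r` times its `d`-th moment
under `ν i r` tends to `0` as `r → 0`. -/
def UniformMomentBound {d : ℕ} (π : ℝ → Measure (Fin d → ℝ))
    (ν : Fin d → ℝ → Measure (Fin d → ℝ)) : Prop :=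
  ∀ i k : Fin d,
    (∃ r₁ > (0 : ℝ), ∃ C : ℝ, ∀ r ∈ Set.Ioo (0 : ℝ) (min r₁ 1),
      (∫ z, (r ^ ((k : ℕ) + 1) * z k) ^ d ∂(π r)) ≤ C) ∧
    Tendsto (fun r : ℝ => r * ∫ z, (r ^ ((k : ℕ) + 1) * z k) ^ d ∂(ν i r))
      (nhdsWithin 0 (Set.Ioo 0 1)) (nhds 0)

/-- The truncation function `κ`. -/
def kappa (x : ℝ) : ℝ :=
  if x ≤ 1 then x
  else if x ≤ 2 then 3*x^5 - 22*x^4 + 62*x^3 - 84*x^2 + 56*x - 14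
  else 2

/-- The vector `θ_k^{(r)} = ∑_{ℓ=k}^d r^ℓ η_ℓ u_ℓ`. -/
def thetaK {d : ℕ} (u : Fin d → Fin d → ℝ) (η : Fin d → ℝ) (k : Fin d) (r : ℝ) :
    Fin d → ℝ :=
  fun j => ∑ ℓ ∈ Finset.univ.filter (fun ℓ => k ≤ ℓ), r ^ ((ℓ : ℕ) + 1) * η ℓ * u ℓ j

/-- The vector `θ̃_k^{(r)} = r^{k+1/2} η_k u_k + ∑_{ℓ=k+1}^d r^ℓ η_ℓ u_ℓ`. -/
def thetaKt {d : ℕ} (u : Fin d → Fin d → ℝ) (η : Fin d → ℝ) (k : Fin d) (r : ℝ) :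
    Fin d → ℝ :=
  fun j => r ^ ((((k : ℕ) : ℝ) + 1) + 1/2) * η k * u k j
    + ∑ ℓ ∈ Finset.univ.filter (fun ℓ => k < ℓ), r ^ ((ℓ : ℕ) + 1) * η ℓ * u ℓ j

/-- The truncated exponential test function `f̃_θ(z) = exp(∑ κ(θ_i z_i))`. -/
def ftilde {d : ℕ} (θ z : Fin d → ℝ) : ℝ := Real.exp (∑ i, kappa (θ i * z i))

/-- Gradient extra term `ε_{g,θ,j}(z) = θ_j (κ'(θ_j z_j) − 1)`. -/
def epsG {d : ℕ} (θ : Fin d → ℝ) (j : Fin d) (z : Fin d → ℝ) : ℝ :=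
  θ j * (deriv kappa (θ j * z j) - 1)

/-- Hessian extra term `ε_{H,θ,ij}(z)`. -/
def epsH {d : ℕ} (θ : Fin d → ℝ) (i j : Fin d) (z : Fin d → ℝ) : ℝ :=
  θ i * θ j * (deriv kappa (θ i * z i) * deriv kappa (θ j * z j) - 1)
    + (if i = j then θ i ^ 2 * deriv (deriv kappa) (θ i * z i) else 0)

/-- The extra term `γ^r(θ)` in the truncated MGF-BAR. -/
def gammaTerm {d : ℕ} (Γ R : Matrix (Fin d) (Fin d) ℝ) (r : ℝ)
    (π : Measure (Fin d → ℝ)) (ν : Fin d → Measure (Fin d → ℝ))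
    (θ : Fin d → ℝ) : ℝ :=
  (1/2) * (∫ z, (∑ i, ∑ j, Γ i j * epsH θ i j z) * ftilde θ z ∂π)
    + ∑ i : Fin d, r ^ ((i : ℕ) + 1) *
        ((∫ z, (∑ j, epsG θ j z * R j i) * ftilde θ z ∂(ν i))
          - ∫ z, (∑ j, epsG θ j z * R j i) * ftilde θ z ∂π)

/-- Adding a nonnegative diagonal matrix keeps the determinant of a matrix with positive
principal minors positive. -/
lemma det_add_diagonal_pos {m : Type} [Fintype m] [DecidableEq m] (T : Matrix m m ℝ)
    (hT : ∀ s : Finset m,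
      0 < (T.submatrix (fun i : s => (i : m)) (fun i : s => (i : m))).det)
    (D : m → ℝ) (hD : ∀ i, 0 ≤ D i) : 0 < (T + Matrix.diagonal D).det := by
  classical
  have key : ∀ s : Finset m, (Matrix.of (s.piecewise T (Matrix.diagonal D))).det =
      (T.submatrix (fun i : s => (i : m)) (fun i : s => (i : m))).det *
        ∏ i : {i // ¬ i ∈ s}, D i := by
    intro s
    have h1 : (Matrix.of (s.piecewise T (Matrix.diagonal D))).toSquareBlockProp (fun i => i ∈ s) =
        T.submatrix (fun i : s => (i : m)) (fun i : s => (i : m)) := by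
      ext i j
      have hi : (i : m) ∈ s := i.2
      exact congrFun (Finset.piecewise_eq_of_mem s (T : m → m → ℝ) (Matrix.diagonal D) hi) j
    have h2 : (Matrix.of (s.piecewise T (Matrix.diagonal D))).toSquareBlockProp (fun i => ¬ i ∈ s) =
        Matrix.diagonal fun i : {i // ¬ i ∈ s} => D i := by
      ext i j
      have hi : (i : m) ∉ s := i.2
      refine (congrFun (Finset.piecewise_eq_of_notMem s (T : m → m → ℝ)
        (Matrix.diagonal D) hi) j).trans ?_
      simp only [Matrix.diagonal_apply, Subtype.ext_iff]
    rw [Matrix.twoBlockTriangular_det _ (fun i => i ∈ s), h2, Matrix.det_diagonal, h1]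
    · congr!
    · intro i hi j hj
      have hij : i ≠ j := fun h => hi (h ▸ hj)
      refine (congrFun (Finset.piecewise_eq_of_notMem s (T : m → m → ℝ)
        (Matrix.diagonal D) hi) j).trans ?_
      exact Matrix.diagonal_apply_ne _ hij
  have hsum : (T + Matrix.diagonal D).det =
      ∑ s : Finset m, (Matrix.of (s.piecewise T (Matrix.diagonal D))).det :=
    (Matrix.detRowAlternating (R := ℝ) (n := m)).toMultilinearMap.map_add_univ T
      (Matrix.diagonal D)
  rw [hsum]
  simp_rw [key]
  refine Finset.sum_pos' (fun s _ => mul_nonneg (hT s).le (Finset.prod_nonneg fun i _ => hD i))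
    ⟨Finset.univ, Finset.mem_univ _, ?_⟩
  refine mul_pos (hT _) (Finset.prod_pos ?_)
  rintro ⟨i, hi⟩ _
  exact absurd (Finset.mem_univ i) hi

/-- Positivity of the determinant of a principal submatrix indexed by an injection. -/
lemma IsPMatrix.det_submatrix_pos {d : ℕ} {R : Matrix (Fin d) (Fin d) ℝ} (hR : IsPMatrix R)
    {m : Type} [Fintype m] [DecidableEq m] (e : m → Fin d) (he : Function.Injective e) :
    0 < (R.submatrix e e).det := by
  classical
  have hm : ∀ x, e x ∈ Finset.univ.image e := fun x => Finset.mem_image_of_mem e (Finset.mem_univ x)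
  let f : m ≃ (Finset.univ.image e : Finset (Fin d)) :=
    Equiv.ofBijective (fun x => ⟨e x, hm x⟩) ⟨fun a b h => he (Subtype.ext_iff.1 h), by
      rintro ⟨y, hy⟩
      obtain ⟨x, -, rfl⟩ := Finset.mem_image.1 hy
      exact ⟨x, rfl⟩⟩
  have := hR (Finset.univ.image e)
  rw [← Matrix.det_submatrix_equiv_self f] at this
  exact this

/-- A Z-matrix with positive principal minors is monotone (acting on row vectors). -/
lemma nonneg_of_vecMul_nonneg {m : Type} [Fintype m] [DecidableEq m] (T : Matrix m m ℝ)
    (hZ : ∀ i j, i ≠ j → T i j ≤ 0)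
    (hP : ∀ (n : Type) [Fintype n] [DecidableEq n] (e : n → m), Function.Injective e →
      0 < (T.submatrix e e).det)
    (p : m → ℝ) (hp : ∀ l, 0 ≤ ∑ j, p j * T j l) (i : m) : 0 ≤ p i := by
  classical
  by_contra hi
  push Not at hi
  let n := {j : m // p j < 0}
  let S : Matrix n n ℝ := T.submatrix Subtype.val Subtype.val
  let q : n → ℝ := fun j => p j
  have hq : ∀ l : n, 0 ≤ ∑ j : n, q j * S j l := by
    intro l
    have h1 : ∑ j, p j * T j l = ∑ j : n, p j * T j l + ∑ j : {j // ¬ p j < 0}, p j * T j l :=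
      (Fintype.sum_subtype_add_sum_subtype (fun j => p j < 0) (fun j => p j * T j l)).symm
    have h2 : ∑ j : {j // ¬ p j < 0}, p j * T j l ≤ 0 := by
      refine Finset.sum_nonpos fun j _ => mul_nonpos_of_nonneg_of_nonpos (not_lt.1 j.2) (hZ _ _ ?_)
      intro h
      exact j.2 (h ▸ l.2)
    have h3 := hp l
    have h4 : ∑ j : n, q j * S j l = ∑ j : n, p j * T j l := rfl
    linarith
  have hdet := det_add_diagonal_pos S
    (fun s => by
      have := hP s (fun i => ((i : n) : m)) (fun a b h => Subtype.ext (Subtype.ext h))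
      exact this)
    (fun l => -(∑ j : n, q j * S j l) / q l)
    (fun l => div_nonneg_of_nonpos (neg_nonpos.2 (hq l)) l.2.le)
  have hz : (Matrix.vecMul q (S + Matrix.diagonal fun l => -(∑ j : n, q j * S j l) / q l)) = 0 := by
    ext l
    rw [Matrix.vecMul_add, Pi.add_apply, Matrix.vecMul_diagonal]
    have : q l ≠ 0 := l.2.ne
    simp only [Matrix.vecMul, dotProduct, Pi.zero_apply]
    field_simp
    ring
  have := Matrix.exists_vecMul_eq_zero_iff.1 ⟨q, fun h => hi.ne (congrFun h ⟨i, hi⟩), hz⟩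
  exact hdet.ne' this

/-- For an M-matrix `R`, the system `vᵀ R = bᵀ` restricted to a principal block has a nonnegative
solution when `b` is nonnegative. -/
lemma IsMMatrix.exists_nonneg_solution {d : ℕ} {R : Matrix (Fin d) (Fin d) ℝ} (hR : IsMMatrix R)
    (s : Finset (Fin d)) (b : Fin d → ℝ) (hb : ∀ i, 0 ≤ b i) :
    ∃ v : Fin d → ℝ, (∀ j, 0 ≤ v j) ∧ (∀ j, j ∉ s → v j = 0) ∧
      ∀ l ∈ s, ∑ j, v j * R j l = b l := by
  classical
  let T : Matrix s s ℝ := R.submatrix Subtype.val Subtype.val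
  have hdet : IsUnit T.det := (hR.2 s).ne'.isUnit
  let w : s → ℝ := Matrix.vecMul (fun i : s => b i) T⁻¹
  have hw : ∀ l : s, ∑ j : s, w j * T j l = b l := by
    intro l
    have : Matrix.vecMul w T = fun i : s => b i := by
      simp only [w, Matrix.vecMul_vecMul, Matrix.nonsing_inv_mul _ hdet, Matrix.vecMul_one]
    exact congrFun this l
  have hw0 : ∀ j, 0 ≤ w j := by
    refine nonneg_of_vecMul_nonneg T (fun i j hij => hR.1 _ _ fun h => hij (Subtype.ext h)) ?_ w
      (fun l => (hw l).symm ▸ hb l)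
    intro n _ _ e he
    exact hR.2.det_submatrix_pos (fun x => ((e x : s) : Fin d))
      (fun a b h => he (Subtype.ext h))
  refine ⟨fun j => if h : j ∈ s then w ⟨j, h⟩ else 0, ?_, ?_, ?_⟩
  · intro j
    dsimp only
    split_ifs
    · exact hw0 _
    · exact le_rfl
  · intro j hj
    simp [hj]
  · intro l hl
    rw [← hw ⟨l, hl⟩, ← Finset.sum_subset (Finset.subset_univ s), ← Finset.sum_coe_sort s]
    · refine Finset.sum_congr rfl fun j _ => ?_
      simp [T]
    · intro j _ hj
      simp [hj]

/-- A nonnegative direction supported on `{j ≤ k}` whose pairing with column `k` is `1`, vanishes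
on earlier columns and is nonpositive on later ones. -/
lemma IsMMatrix.exists_direction {d : ℕ} {R : Matrix (Fin d) (Fin d) ℝ} (hR : IsMMatrix R)
    (k : Fin d) :
    ∃ u : Fin d → ℝ, (∀ j, 0 ≤ u j) ∧ 0 < u k ∧ (∀ j, k < j → u j = 0) ∧ uR R u k = 1 ∧
      (∀ l, l < k → uR R u l = 0) ∧ ∀ l, k < l → uR R u l ≤ 0 := by
  classical
  obtain ⟨u, hu0, hus, hu⟩ := hR.exists_nonneg_solution (Finset.univ.filter (· ≤ k))
    (Pi.single k 1) (fun i => by by_cases h : i = k <;> simp [h])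
  have huk : uR R u k = 1 := by simpa [uR] using hu k (by simp)
  have hgt : ∀ j, k < j → u j = 0 := fun j hj => hus j (by simpa using hj)
  refine ⟨u, hu0, ?_, hgt, huk, ?_, ?_⟩
  · refine (hu0 k).lt_of_ne fun h => ?_
    have : uR R u k ≤ 0 := by
      refine Finset.sum_nonpos fun j _ => ?_
      by_cases hj : j = k
      · rw [hj, ← h]; simp
      · exact mul_nonpos_of_nonneg_of_nonpos (hu0 j) (hR.1 _ _ hj)
    linarith
  · intro l hl
    have := hu l (by simpa using hl.le)
    rwa [Pi.single_eq_of_ne hl.ne] at this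
  · intro l hl
    refine Finset.sum_nonpos fun j _ => ?_
    by_cases hj : j = l
    · rw [hj, hgt l hl]; simp
    · exact mul_nonpos_of_nonneg_of_nonpos (hu0 j) (hR.1 _ _ hj)

/-- The continuous linear form `z ↦ ∑ j, b j * z j`. -/
def linForm {d : ℕ} (b : Fin d → ℝ) : (Fin d → ℝ) →L[ℝ] ℝ :=
  ∑ j, b j • ContinuousLinearMap.proj j

lemma linForm_apply {d : ℕ} (b z : Fin d → ℝ) : linForm b z = ∑ j, b j * z j := by
  simp [linForm]

lemma linForm_single {d : ℕ} (b : Fin d → ℝ) (j : Fin d) : linForm b (Pi.single j 1) = b j := by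
  classical
  simp [linForm_apply, Pi.single_apply]

lemma linForm_nonneg {d : ℕ} {b z : Fin d → ℝ} (hb : ∀ j, 0 ≤ b j) (hz : z ∈ posOrthant d) :
    0 ≤ linForm b z := by
  rw [linForm_apply]
  exact Finset.sum_nonneg fun j _ => mul_nonneg (hb j) (hz j)

/-- The product of two ridge functions, `z ↦ P (b ⬝ z) * G (c ⬝ z)`. -/
def ridgeProd {d : ℕ} (P G : ℝ → ℝ) (b c : Fin d → ℝ) (z : Fin d → ℝ) : ℝ :=
  P (linForm b z) * G (linForm c z)

lemma pd1_ridgeProd {d : ℕ} {P P1 G G1 : ℝ → ℝ} (hP : ∀ t, HasDerivAt P (P1 t) t)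
    (hG : ∀ t, HasDerivAt G (G1 t) t) (b c : Fin d → ℝ) (j : Fin d) (z : Fin d → ℝ) :
    pd1 (ridgeProd P G b c) j z =
      b j * ridgeProd P1 G b c z + c j * ridgeProd P G1 b c z := by
  have h1 := (hP (linForm b z)).comp_hasFDerivAt z (linForm b).hasFDerivAt
  have h2 := (hG (linForm c z)).comp_hasFDerivAt z (linForm c).hasFDerivAt
  have h3 : HasFDerivAt (ridgeProd P G b c) _ z := h1.mul h2
  rw [pd1, h3.fderiv]
  simp only [ridgeProd, Function.comp_apply, add_apply,
    smul_apply, linForm_single, smul_eq_mul]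
  ring

lemma differentiable_ridgeProd {d : ℕ} {P P1 G G1 : ℝ → ℝ} (hP : ∀ t, HasDerivAt P (P1 t) t)
    (hG : ∀ t, HasDerivAt G (G1 t) t) (b c : Fin d → ℝ) :
    Differentiable ℝ (ridgeProd P G b c) := fun z =>
  (((hP (linForm b z)).comp_hasFDerivAt z (linForm b).hasFDerivAt).mul
    ((hG (linForm c z)).comp_hasFDerivAt z (linForm c).hasFDerivAt)).differentiableAt

lemma pd2_ridgeProd {d : ℕ} {P P1 P2 G G1 G2 : ℝ → ℝ} (hP : ∀ t, HasDerivAt P (P1 t) t)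
    (hP1 : ∀ t, HasDerivAt P1 (P2 t) t) (hG : ∀ t, HasDerivAt G (G1 t) t)
    (hG1 : ∀ t, HasDerivAt G1 (G2 t) t) (b c : Fin d → ℝ) (i j : Fin d) (z : Fin d → ℝ) :
    pd2 (ridgeProd P G b c) i j z =
      b i * b j * ridgeProd P2 G b c z + (b j * c i + c j * b i) * ridgeProd P1 G1 b c z
        + c i * c j * ridgeProd P G2 b c z := by
  have h : (fun w => pd1 (ridgeProd P G b c) j w) =
      (fun w => b j * ridgeProd P1 G b c w + c j * ridgeProd P G1 b c w) :=
    funext fun w => pd1_ridgeProd hP hG b c j w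
  have h1 := (differentiable_ridgeProd hP1 hG b c z).hasFDerivAt
  have h2 := (differentiable_ridgeProd hP hG1 b c z).hasFDerivAt
  have e1 := pd1_ridgeProd hP1 hG b c i z
  have e2 := pd1_ridgeProd hP hG1 b c i z
  rw [pd1] at e1 e2
  have h3 : HasFDerivAt (fun w => b j * ridgeProd P1 G b c w + c j * ridgeProd P G1 b c w) _ z :=
    (h1.const_mul (b j)).add (h2.const_mul (c j))
  rw [pd2, h, h3.fderiv]
  simp only [add_apply, smul_apply, smul_eq_mul, e1, e2]
  ring

lemma abs_ridgeProd_le {d : ℕ} {P G : ℝ → ℝ} {B : ℝ} (hP : ∀ t, 0 ≤ t → |P t| ≤ B)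
    (hG : ∀ t, 0 ≤ t → |G t| ≤ B) {b c : Fin d → ℝ} (hb : ∀ j, 0 ≤ b j) (hc : ∀ j, 0 ≤ c j)
    {z : Fin d → ℝ} (hz : z ∈ posOrthant d) : |ridgeProd P G b c z| ≤ B * B := by
  rw [ridgeProd, abs_mul]
  exact mul_le_mul (hP _ (linForm_nonneg hb hz)) (hG _ (linForm_nonneg hc hz)) (abs_nonneg _)
    ((abs_nonneg _).trans (hP _ (linForm_nonneg hb hz)))

lemma isC2Bounded_ridgeProd {d : ℕ} {P P1 P2 G G1 G2 : ℝ → ℝ} {B : ℝ}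
    (hP : ∀ t, HasDerivAt P (P1 t) t)
    (hP1 : ∀ t, HasDerivAt P1 (P2 t) t) (hG : ∀ t, HasDerivAt G (G1 t) t)
    (hG1 : ∀ t, HasDerivAt G1 (G2 t) t) (cP : ContDiff ℝ 2 P) (cG : ContDiff ℝ 2 G)
    (bP : ∀ t, 0 ≤ t → |P t| ≤ B) (bP1 : ∀ t, 0 ≤ t → |P1 t| ≤ B) (bP2 : ∀ t, 0 ≤ t → |P2 t| ≤ B)
    (bG : ∀ t, 0 ≤ t → |G t| ≤ B) (bG1 : ∀ t, 0 ≤ t → |G1 t| ≤ B) (bG2 : ∀ t, 0 ≤ t → |G2 t| ≤ B)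
    {b c : Fin d → ℝ} (hb : ∀ j, 0 ≤ b j) (hc : ∀ j, 0 ≤ c j) :
    IsC2Bounded (ridgeProd P G b c) := by
  refine ⟨(cP.comp (linForm b).contDiff).mul (cG.comp (linForm c).contDiff), ?_⟩
  set M : ℝ := ∑ j, (b j + c j) with hM
  have hM0 : 0 ≤ M := Finset.sum_nonneg fun j _ => add_nonneg (hb j) (hc j)
  have hbc : ∀ j, b j + c j ≤ M := fun j =>
    Finset.single_le_sum (f := fun j => b j + c j) (fun j _ => add_nonneg (hb j) (hc j))
      (Finset.mem_univ j)
  have hB : 0 ≤ B * B := mul_self_nonneg B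
  refine ⟨(1 + M + M * M) * (B * B), fun z hz => ⟨?_, fun j => ?_, fun i j => ?_⟩⟩
  · refine (abs_ridgeProd_le bP bG hb hc hz).trans ?_
    nlinarith [mul_nonneg hM0 hB, mul_nonneg (mul_nonneg hM0 hM0) hB]
  · rw [pd1_ridgeProd hP hG]
    have h1 := abs_ridgeProd_le bP1 bG hb hc hz
    have h2 := abs_ridgeProd_le bP bG1 hb hc hz
    calc _ ≤ b j * (B * B) + c j * (B * B) := by
          refine (abs_add_le _ _).trans ?_
          rw [abs_mul, abs_mul, abs_of_nonneg (hb j), abs_of_nonneg (hc j)]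
          gcongr
          exacts [hb j, hc j]
      _ = (b j + c j) * (B * B) := by ring
      _ ≤ (1 + M + M * M) * (B * B) := by
          refine mul_le_mul_of_nonneg_right ?_ hB
          nlinarith [hbc j]
  · rw [pd2_ridgeProd hP hP1 hG hG1]
    have h1 := abs_ridgeProd_le bP2 bG hb hc hz
    have h2 := abs_ridgeProd_le bP1 bG1 hb hc hz
    have h3 := abs_ridgeProd_le bP bG2 hb hc hz
    have n1 := mul_nonneg (hb i) (hb j)
    have n2 := add_nonneg (mul_nonneg (hb j) (hc i)) (mul_nonneg (hc j) (hb i))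
    have n3 := mul_nonneg (hc i) (hc j)
    calc _ ≤ b i * b j * (B * B) + (b j * c i + c j * b i) * (B * B) + c i * c j * (B * B) := by
          refine (abs_add_three _ _ _).trans ?_
          rw [abs_mul _ (ridgeProd P2 G b c z), abs_mul _ (ridgeProd P1 G1 b c z),
            abs_mul _ (ridgeProd P G2 b c z), abs_of_nonneg n1, abs_of_nonneg n2, abs_of_nonneg n3]
          gcongr
      _ = ((b i + c i) * (b j + c j)) * (B * B) := by ring
      _ ≤ (1 + M + M * M) * (B * B) := by
          refine mul_le_mul_of_nonneg_right ?_ hB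
          nlinarith [mul_le_mul (hbc i) (hbc j) (add_nonneg (hb j) (hc j)) hM0]

/-- The bilinear form `∑ i j, b i * Γ i j * c j`. -/
def bilin {d : ℕ} (Γ : Matrix (Fin d) (Fin d) ℝ) (b c : Fin d → ℝ) : ℝ :=
  ∑ i, ∑ j, b i * Γ i j * c j

lemma sum_pd1_ridgeProd {d : ℕ} {P P1 G G1 : ℝ → ℝ} (hP : ∀ t, HasDerivAt P (P1 t) t)
    (hG : ∀ t, HasDerivAt G (G1 t) t) (R : Matrix (Fin d) (Fin d) ℝ) (b c : Fin d → ℝ)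
    (l : Fin d) (z : Fin d → ℝ) :
    ∑ j, R j l * pd1 (ridgeProd P G b c) j z =
      uR R b l * ridgeProd P1 G b c z + uR R c l * ridgeProd P G1 b c z := by
  simp only [pd1_ridgeProd hP hG, uR, Finset.sum_mul, ← Finset.sum_add_distrib]
  exact Finset.sum_congr rfl fun j _ => by ring

lemma sum_pd2_ridgeProd {d : ℕ} {P P1 P2 G G1 G2 : ℝ → ℝ} (hP : ∀ t, HasDerivAt P (P1 t) t)
    (hP1 : ∀ t, HasDerivAt P1 (P2 t) t) (hG : ∀ t, HasDerivAt G (G1 t) t)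
    (hG1 : ∀ t, HasDerivAt G1 (G2 t) t) (Γ : Matrix (Fin d) (Fin d) ℝ) (b c : Fin d → ℝ)
    (z : Fin d → ℝ) :
    ∑ i, ∑ j, Γ i j * pd2 (ridgeProd P G b c) i j z =
      bilin Γ b b * ridgeProd P2 G b c z + (bilin Γ b c + bilin Γ c b) * ridgeProd P1 G1 b c z
        + bilin Γ c c * ridgeProd P G2 b c z := by
  simp only [pd2_ridgeProd hP hP1 hG hG1, bilin, Finset.sum_mul, add_mul,
    ← Finset.sum_add_distrib]
  exact Finset.sum_congr rfl fun i _ => Finset.sum_congr rfl fun j _ => by ring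

lemma abs_bilin_le {d : ℕ} (Γ : Matrix (Fin d) (Fin d) ℝ) {b c : Fin d → ℝ} {B C : ℝ}
    (hb : ∀ j, |b j| ≤ B) (hc : ∀ j, |c j| ≤ C) :
    |bilin Γ b c| ≤ B * C * ∑ i, ∑ j, |Γ i j| := by
  rw [Finset.mul_sum]
  refine (Finset.abs_sum_le_sum_abs _ _).trans (Finset.sum_le_sum fun i _ => ?_)
  rw [Finset.mul_sum]
  refine (Finset.abs_sum_le_sum_abs _ _).trans (Finset.sum_le_sum fun j _ => ?_)
  rw [abs_mul, abs_mul, mul_assoc, mul_comm |Γ i j|, ← mul_assoc]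
  have h1 := hb i
  have h2 := hc j
  have : 0 ≤ B := (abs_nonneg _).trans h1
  gcongr

lemma abs_uR_le {d : ℕ} (R : Matrix (Fin d) (Fin d) ℝ) {b : Fin d → ℝ} {B : ℝ}
    (hb : ∀ j, |b j| ≤ B) (l : Fin d) : |uR R b l| ≤ B * ∑ i, ∑ j, |R i j| := by
  rw [Finset.mul_sum]
  refine (Finset.abs_sum_le_sum_abs _ _).trans (Finset.sum_le_sum fun i _ => ?_)
  rw [abs_mul]
  have h1 := hb i
  have : 0 ≤ B := (abs_nonneg _).trans h1
  gcongr
  exact Finset.single_le_sum (f := fun j => |R i j|) (fun _ _ => abs_nonneg _) (Finset.mem_univ l)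

/-- The saturated exponential `e^t / (1 + δ e^t)`. -/
def satExp (δ t : ℝ) : ℝ := Real.exp t / (1 + δ * Real.exp t)

/-- The first derivative of `satExp δ`. -/
def satExp1 (δ t : ℝ) : ℝ := Real.exp t / (1 + δ * Real.exp t) ^ 2

/-- The second derivative of `satExp δ`. -/
def satExp2 (δ t : ℝ) : ℝ := Real.exp t * (1 - δ * Real.exp t) / (1 + δ * Real.exp t) ^ 3

lemma satExp_denom_pos {δ : ℝ} (hδ : 0 < δ) (t : ℝ) : 1 < 1 + δ * Real.exp t := by
  have := mul_pos hδ (Real.exp_pos t)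
  linarith

lemma hasDerivAt_satExp {δ : ℝ} (hδ : 0 < δ) (t : ℝ) :
    HasDerivAt (satExp δ) (satExp1 δ t) t := by
  have h0 : 1 + δ * Real.exp t ≠ 0 := by linarith [satExp_denom_pos hδ t]
  have h : HasDerivAt (satExp δ) _ t :=
    (Real.hasDerivAt_exp t).div (((Real.hasDerivAt_exp t).const_mul δ).const_add 1) h0
  refine h.congr_deriv ?_
  unfold satExp1
  congr 1
  ring

lemma hasDerivAt_satExp1 {δ : ℝ} (hδ : 0 < δ) (t : ℝ) :
    HasDerivAt (satExp1 δ) (satExp2 δ t) t := by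
  have h0 : 1 + δ * Real.exp t ≠ 0 := by linarith [satExp_denom_pos hδ t]
  have h : HasDerivAt (satExp1 δ) _ t := (Real.hasDerivAt_exp t).div
    ((((Real.hasDerivAt_exp t).const_mul δ).const_add 1).pow 2) (pow_ne_zero 2 h0)
  refine h.congr_deriv ?_
  simp only [satExp2]
  field_simp
  ring

lemma contDiff_satExp {δ : ℝ} (hδ : 0 < δ) : ContDiff ℝ 2 (satExp δ) :=
  Real.contDiff_exp.div (contDiff_const.add (contDiff_const.mul Real.contDiff_exp))
    fun t => by linarith [satExp_denom_pos hδ t]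

lemma continuous_satExp {δ : ℝ} (hδ : 0 < δ) : Continuous (satExp δ) :=
  (contDiff_satExp hδ).continuous

lemma continuous_satExp1 {δ : ℝ} (hδ : 0 < δ) : Continuous (satExp1 δ) :=
  continuous_iff_continuousAt.2 fun t => (hasDerivAt_satExp1 hδ t).continuousAt

lemma satExp1_pos {δ : ℝ} (hδ : 0 < δ) (t : ℝ) : 0 < satExp1 δ t :=
  div_pos (Real.exp_pos t) (pow_pos (by linarith [satExp_denom_pos hδ t]) 2)

lemma satExp1_le {δ : ℝ} (hδ : 0 < δ) (t : ℝ) : satExp1 δ t ≤ satExp δ t := by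
  have h := satExp_denom_pos hδ t
  refine div_le_div_of_nonneg_left (Real.exp_pos t).le (by linarith) ?_
  nlinarith

lemma satExp_pos {δ : ℝ} (hδ : 0 < δ) (t : ℝ) : 0 < satExp δ t :=
  (satExp1_pos hδ t).trans_le (satExp1_le hδ t)

lemma abs_satExp2_le {δ : ℝ} (hδ : 0 < δ) (t : ℝ) : |satExp2 δ t| ≤ satExp1 δ t := by
  have h := satExp_denom_pos hδ t
  have he := mul_pos hδ (Real.exp_pos t)
  have h0 : satExp2 δ t = satExp1 δ t * ((1 - δ * Real.exp t) / (1 + δ * Real.exp t)) := by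
    rw [satExp1, satExp2]
    field_simp
  rw [h0, abs_mul, abs_of_pos (satExp1_pos hδ t)]
  refine mul_le_of_le_one_right (satExp1_pos hδ t).le ?_
  rw [abs_div, abs_of_pos (show 0 < 1 + δ * Real.exp t by linarith), div_le_one (by linarith), abs_le]
  constructor <;> linarith

lemma satExp_le_exp {δ : ℝ} (hδ : 0 < δ) (t : ℝ) : satExp δ t ≤ Real.exp t :=
  div_le_self (Real.exp_pos t).le (satExp_denom_pos hδ t).le

lemma satExp_le_inv {δ : ℝ} (hδ : 0 < δ) (t : ℝ) : satExp δ t ≤ δ⁻¹ := by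
  have h := satExp_denom_pos hδ t
  rw [satExp, div_le_iff₀ (by linarith)]
  field_simp
  linarith

lemma abs_satExp_le {δ : ℝ} (hδ : 0 < δ) (t : ℝ) : |satExp δ t| ≤ δ⁻¹ := by
  rw [abs_of_pos (satExp_pos hδ t)]
  exact satExp_le_inv hδ t

lemma abs_satExp1_le {δ : ℝ} (hδ : 0 < δ) (t : ℝ) : |satExp1 δ t| ≤ δ⁻¹ := by
  rw [abs_of_pos (satExp1_pos hδ t)]
  exact (satExp1_le hδ t).trans (satExp_le_inv hδ t)

lemma tendsto_satExp1 (t : ℝ) :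
    Tendsto (fun n : ℕ => satExp1 (1 / ((n : ℝ) + 1)) t) atTop (nhds (Real.exp t)) := by
  have h : Tendsto (fun n : ℕ => Real.exp t / (1 + (1 / ((n : ℝ) + 1)) * Real.exp t) ^ 2) atTop
      (nhds (Real.exp t / (1 + 0 * Real.exp t) ^ 2)) := by
    refine tendsto_const_nhds.div (((tendsto_one_div_add_atTop_nhds_zero_nat.mul_const _).const_add
      1).pow 2) (by simp)
  simpa [satExp1] using h

/-- If the integrals of the saturated exponentials are bounded uniformly in the saturation level,
the exponential itself is integrable with the same bound. -/
lemma integral_exp_le_of_satExp1 {α : Type*} [MeasurableSpace α] (μ : Measure α)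
    [IsProbabilityMeasure μ] {T : α → ℝ} (hT : Measurable T) {C : ℝ}
    (h : ∀ δ : ℝ, 0 < δ → ∫ z, satExp1 δ (T z) ∂μ ≤ C) :
    Integrable (fun z => Real.exp (T z)) μ ∧ ∫ z, Real.exp (T z) ∂μ ≤ C := by
  have hpos : ∀ n : ℕ, (0 : ℝ) < 1 / ((n : ℝ) + 1) := fun n => by positivity
  have hm : ∀ n : ℕ, Measurable fun z => satExp1 (1 / ((n : ℝ) + 1)) (T z) := fun n =>
    (continuous_satExp1 (hpos n)).measurable.comp hT
  have hint : ∀ n : ℕ, Integrable (fun z => satExp1 (1 / ((n : ℝ) + 1)) (T z)) μ := fun n =>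
    Integrable.of_bound (hm n).aestronglyMeasurable _
      (Eventually.of_forall fun z => abs_satExp1_le (hpos n) _)
  have hC : 0 ≤ C := (integral_nonneg fun z => (satExp1_pos one_pos (T z)).le).trans (h 1 one_pos)
  have hle : ∫⁻ z, ENNReal.ofReal (Real.exp (T z)) ∂μ ≤ ENNReal.ofReal C := by
    calc ∫⁻ z, ENNReal.ofReal (Real.exp (T z)) ∂μ
        = ∫⁻ z, liminf (fun n : ℕ =>
            ENNReal.ofReal (satExp1 (1 / ((n : ℝ) + 1)) (T z))) atTop ∂μ := by
          refine lintegral_congr fun z => ?_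
          exact (ENNReal.tendsto_ofReal (tendsto_satExp1 (T z))).liminf_eq.symm
      _ ≤ liminf (fun n : ℕ =>
            ∫⁻ z, ENNReal.ofReal (satExp1 (1 / ((n : ℝ) + 1)) (T z)) ∂μ) atTop :=
          lintegral_liminf_le fun n => (hm n).ennreal_ofReal
      _ ≤ ENNReal.ofReal C := by
          refine liminf_le_of_le (by isBoundedDefault) fun b hb => ?_
          obtain ⟨n, hn⟩ := hb.exists
          refine hn.trans ?_
          rw [← ofReal_integral_eq_lintegral_ofReal (hint n)
            (Eventually.of_forall fun z => (satExp1_pos (hpos n) _).le)]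
          exact ENNReal.ofReal_le_ofReal (h _ (hpos n))
  have hme : AEStronglyMeasurable (fun z => Real.exp (T z)) μ :=
    (Real.measurable_exp.comp hT).aestronglyMeasurable
  have hI : Integrable (fun z => Real.exp (T z)) μ := by
    refine ⟨hme, ?_⟩
    rw [hasFiniteIntegral_iff_ofReal (Eventually.of_forall fun z => (Real.exp_pos _).le)]
    exact hle.trans_lt ENNReal.ofReal_lt_top
  refine ⟨hI, ?_⟩
  rw [← ofReal_integral_eq_lintegral_ofReal hI
    (Eventually.of_forall fun z => (Real.exp_pos _).le)] at hle
  exact (ENNReal.ofReal_le_ofReal_iff hC).1 hle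

lemma continuous_ridgeProd {d : ℕ} {P G : ℝ → ℝ} (hP : Continuous P) (hG : Continuous G)
    (b c : Fin d → ℝ) : Continuous (ridgeProd P G b c) :=
  (hP.comp (linForm b).continuous).mul (hG.comp (linForm c).continuous)

lemma integrable_ridgeProd {d : ℕ} {μ : Measure (Fin d → ℝ)} [IsProbabilityMeasure μ]
    (hμ : ∀ᵐ z ∂μ, z ∈ posOrthant d) {P G : ℝ → ℝ} {B : ℝ} (cP : Continuous P) (cG : Continuous G)
    (hP : ∀ t, 0 ≤ t → |P t| ≤ B) (hG : ∀ t, 0 ≤ t → |G t| ≤ B) {b c : Fin d → ℝ}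
    (hb : ∀ j, 0 ≤ b j) (hc : ∀ j, 0 ≤ c j) : Integrable (ridgeProd P G b c) μ :=
  Integrable.of_bound (continuous_ridgeProd cP cG b c).aestronglyMeasurable (B * B)
    (hμ.mono fun _ hz => abs_ridgeProd_le hP hG hb hc hz)

lemma integrable_satExp {α : Type*} [MeasurableSpace α] {μ : Measure α} [IsProbabilityMeasure μ]
    {δ : ℝ} (hδ : 0 < δ) {T : α → ℝ} (hT : Measurable T) :
    Integrable (fun z => satExp δ (T z)) μ :=
  Integrable.of_bound ((continuous_satExp hδ).measurable.comp hT).aestronglyMeasurable _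
    (Eventually.of_forall fun _ => abs_satExp_le hδ _)

lemma integrable_satExp1 {α : Type*} [MeasurableSpace α] {μ : Measure α} [IsProbabilityMeasure μ]
    {δ : ℝ} (hδ : 0 < δ) {T : α → ℝ} (hT : Measurable T) :
    Integrable (fun z => satExp1 δ (T z)) μ :=
  Integrable.of_bound ((continuous_satExp1 hδ).measurable.comp hT).aestronglyMeasurable _
    (Eventually.of_forall fun _ => abs_satExp1_le hδ _)

lemma uR_const_mul {d : ℕ} (R : Matrix (Fin d) (Fin d) ℝ) (t : ℝ) (u : Fin d → ℝ) (l : Fin d) :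
    uR R (fun j => t * u j) l = t * uR R u l := by
  simp only [uR, Finset.mul_sum, mul_assoc]

lemma bilin_const_mul {d : ℕ} (Γ : Matrix (Fin d) (Fin d) ℝ) (t : ℝ) (u : Fin d → ℝ) :
    bilin Γ (fun j => t * u j) (fun j => t * u j) = t ^ 2 * bilin Γ u u := by
  simp only [bilin, Finset.mul_sum]
  exact Finset.sum_congr rfl fun i _ => Finset.sum_congr rfl fun j _ => by ring

/-- The BAR for a saturated exponential of a linear form. -/
lemma SatisfiesBAR.satExp_linForm {d : ℕ} {Γ R : Matrix (Fin d) (Fin d) ℝ} {r : ℝ}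
    {π : Measure (Fin d → ℝ)} {ν : Fin d → Measure (Fin d → ℝ)} (h : SatisfiesBAR Γ R r π ν)
    {c : Fin d → ℝ} (hc : ∀ j, 0 ≤ c j) {δ : ℝ} (hδ : 0 < δ) :
    1 / 2 * (bilin Γ c c * ∫ z, satExp2 δ (linForm c z) ∂π)
      - (∑ l : Fin d, r ^ ((l : ℕ) + 1) * (uR R c l * ∫ z, satExp1 δ (linForm c z) ∂π))
      + (∑ l : Fin d, r ^ ((l : ℕ) + 1) * (uR R c l * ∫ z, satExp1 δ (linForm c z) ∂(ν l))) = 0 := by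
  have hP : ∀ t : ℝ, HasDerivAt (fun _ : ℝ => (1 : ℝ)) ((fun _ : ℝ => (0 : ℝ)) t) t :=
    fun t => hasDerivAt_const t 1
  have hP1 : ∀ t : ℝ, HasDerivAt (fun _ : ℝ => (0 : ℝ)) ((fun _ : ℝ => (0 : ℝ)) t) t :=
    fun t => hasDerivAt_const t 0
  have hB1 : (1 : ℝ) ≤ max 1 δ⁻¹ := le_max_left _ _
  have hB2 : δ⁻¹ ≤ max 1 δ⁻¹ := le_max_right _ _
  have key := h (ridgeProd (fun _ => 1) (satExp δ) (0 : Fin d → ℝ) c)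
    (isC2Bounded_ridgeProd (B := max 1 δ⁻¹) hP hP1 (hasDerivAt_satExp hδ) (hasDerivAt_satExp1 hδ)
      contDiff_const (contDiff_satExp hδ) (fun _ _ => by simp)
      (fun _ _ => by simp) (fun _ _ => by simp)
      (fun t _ => (abs_satExp_le hδ t).trans hB2) (fun t _ => (abs_satExp1_le hδ t).trans hB2)
      (fun t _ => (abs_satExp2_le hδ t).trans ((le_abs_self _).trans ((abs_satExp1_le hδ t).trans hB2)))
      (fun _ => le_rfl) hc)
  simp only [sum_pd2_ridgeProd hP hP1 (hasDerivAt_satExp hδ) (hasDerivAt_satExp1 hδ),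
    sum_pd1_ridgeProd hP (hasDerivAt_satExp hδ)] at key
  simpa [ridgeProd, integral_const_mul] using key

/-- Comparison of the stationary and boundary integrals of a saturated exponential in a direction
that is orthogonal to the earlier reflection vectors. -/
lemma SatisfiesBAR.integral_satExp1_le {d : ℕ} {Γ R : Matrix (Fin d) (Fin d) ℝ} {r : ℝ}
    {π : Measure (Fin d → ℝ)} {ν : Fin d → Measure (Fin d → ℝ)} (h : SatisfiesBAR Γ R r π ν)
    [IsProbabilityMeasure π] (hr0 : 0 < r) (hr1 : r < 1)
    {k : Fin d} {u : Fin d → ℝ} (hu : ∀ j, 0 ≤ u j) (huk : uR R u k = 1)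
    (hlt : ∀ l, l < k → uR R u l = 0) (hgt : ∀ l, k < l → uR R u l ≤ 0)
    {η : ℝ} (hη : 0 < η) (hηq : η * |bilin Γ u u| ≤ 1 / 2) (hrS : r * ∑ l, |uR R u l| ≤ 1 / 4)
    {δ : ℝ} (hδ : 0 < δ) :
    ∫ z, satExp1 δ (linForm (fun j => η * r ^ ((k : ℕ) + 1) * u j) z) ∂π ≤
      2 * ∫ z, satExp1 δ (linForm (fun j => η * r ^ ((k : ℕ) + 1) * u j) z) ∂(ν k) := by
  classical
  set ρ : ℝ := r ^ ((k : ℕ) + 1) with hρ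
  have hρ0 : 0 < ρ := by positivity
  set c : Fin d → ℝ := fun j => η * ρ * u j with hc
  have key := h.satExp_linForm (c := c) (fun j => by have := hu j; positivity) hδ
  set I1 := ∫ z, satExp1 δ (linForm c z) ∂π with hI1
  set I2 := ∫ z, satExp2 δ (linForm c z) ∂π with hI2
  have hI1n : 0 ≤ I1 := integral_nonneg fun z => (satExp1_pos hδ _).le
  have hJn : ∀ l, 0 ≤ ∫ z, satExp1 δ (linForm c z) ∂(ν l) := fun l =>
    integral_nonneg fun z => (satExp1_pos hδ _).le
  have hI2le : |I2| ≤ I1 := by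
    rw [hI2, hI1, ← Real.norm_eq_abs]
    exact norm_integral_le_of_norm_le (integrable_satExp1 hδ (linForm c).continuous.measurable)
      (Eventually.of_forall fun z => abs_satExp2_le hδ _)
  rw [hc, bilin_const_mul, ← hc] at key
  simp only [hc, uR_const_mul] at key
  simp only [← hc] at key
  set J : Fin d → ℝ := fun l => ∫ z, satExp1 δ (linForm c z) ∂(ν l) with hJ
  have hpow : ∀ l, k < l → r ^ ((l : ℕ) + 1) ≤ r * ρ := by
    intro l hl
    rw [hρ, ← pow_succ']
    have : (k : ℕ) < l := hl
    exact pow_le_pow_of_le_one hr0.le hr1.le (by omega)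
  have hlow : ∀ l : Fin d, (Pi.single k ρ : Fin d → ℝ) l - r * ρ * |uR R u l| ≤
      r ^ ((l : ℕ) + 1) * uR R u l := by
    intro l
    rcases lt_trichotomy l k with hl | rfl | hl
    · simp [Pi.single_eq_of_ne hl.ne, hlt l hl]
    · simp only [Pi.single_eq_same, huk, abs_one, mul_one, ← hρ]
      nlinarith
    · rw [Pi.single_eq_of_ne hl.ne', abs_of_nonpos (hgt l hl)]
      nlinarith [hpow l hl, hgt l hl]
  have hup : ∀ l : Fin d, r ^ ((l : ℕ) + 1) * (uR R u l * J l) ≤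
      (Pi.single k (ρ * J k) : Fin d → ℝ) l := by
    intro l
    rcases lt_trichotomy l k with hl | rfl | hl
    · simp [Pi.single_eq_of_ne hl.ne, hlt l hl]
    · simp [huk, hρ]
    · rw [Pi.single_eq_of_ne hl.ne']
      exact mul_nonpos_of_nonneg_of_nonpos (by positivity)
        (mul_nonpos_of_nonpos_of_nonneg (hgt l hl) (hJn l))
  have hlows := Finset.sum_le_sum fun l (_ : l ∈ Finset.univ) => hlow l
  have hups := Finset.sum_le_sum fun l (_ : l ∈ Finset.univ) => hup l
  rw [Finset.sum_sub_distrib, ← Finset.mul_sum, Finset.sum_pi_single'] at hlows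
  rw [Finset.sum_pi_single'] at hups
  simp only [Finset.mem_univ, if_true] at hlows hups
  set A := ∑ l : Fin d, r ^ ((l : ℕ) + 1) * uR R u l with hA
  set Bd := ∑ l : Fin d, r ^ ((l : ℕ) + 1) * (uR R u l * J l) with hBd
  have e1 : ∑ l : Fin d, r ^ ((l : ℕ) + 1) * (η * ρ * uR R u l * I1) = η * ρ * (A * I1) := by
    rw [hA, Finset.sum_mul, Finset.mul_sum]
    exact Finset.sum_congr rfl fun l _ => by ring
  have e2 : ∑ l : Fin d, r ^ ((l : ℕ) + 1) * (η * ρ * uR R u l * J l) = η * ρ * Bd := by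
    rw [hBd, Finset.mul_sum]
    exact Finset.sum_congr rfl fun l _ => by ring
  have key' : 1 / 2 * ((η * ρ) ^ 2 * bilin Γ u u * I2) - η * ρ * (A * I1) + η * ρ * Bd = 0 := by
    rw [← e1, ← e2]
    exact key
  have key2 : A * I1 = Bd + 1 / 2 * (η * ρ * (bilin Γ u u * I2)) := by
    have : η * ρ ≠ 0 := by positivity
    apply mul_left_cancel₀ this
    linarith
  have hqI : η * (bilin Γ u u * I2) ≤ 1 / 2 * I1 := by
    calc η * (bilin Γ u u * I2) ≤ η * (|bilin Γ u u| * |I2|) := by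
          rw [← abs_mul]
          exact mul_le_mul_of_nonneg_left (le_abs_self _) hη.le
      _ = (η * |bilin Γ u u|) * |I2| := by ring
      _ ≤ 1 / 2 * I1 := mul_le_mul hηq hI2le (abs_nonneg _) (by norm_num)
  have hA' : ρ * (3 / 4) ≤ A := by
    refine le_trans ?_ hlows
    nlinarith
  have h1 : ρ * (3 / 4) * I1 ≤ A * I1 := mul_le_mul_of_nonneg_right hA' hI1n
  have h2 : ρ * (η * (bilin Γ u u * I2)) ≤ ρ * (1 / 2 * I1) := mul_le_mul_of_nonneg_left hqI hρ0.le
  have h3 : ρ * I1 ≤ ρ * (2 * J k) := by nlinarith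
  exact le_of_mul_le_mul_left h3 hρ0

/-- The bounded increasing function `(1 - e^{-s}) / r`. -/
def ramp (r s : ℝ) : ℝ := (1 - Real.exp (-s)) / r

lemma hasDerivAt_exp_neg (t : ℝ) : HasDerivAt (fun s => Real.exp (-s)) (-Real.exp (-t)) t := by
  simpa using (hasDerivAt_neg t).exp

lemma hasDerivAt_ramp (r t : ℝ) : HasDerivAt (ramp r) (Real.exp (-t) / r) t := by
  have h : HasDerivAt (ramp r) _ t := ((hasDerivAt_exp_neg t).const_sub 1).div_const r
  simpa using h

lemma ramp_nonneg {r : ℝ} (hr : 0 < r) {t : ℝ} (ht : 0 ≤ t) : 0 ≤ ramp r t :=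
  div_nonneg (sub_nonneg.2 (Real.exp_le_one_iff.2 (by linarith))) hr.le

lemma abs_ramp_le {r : ℝ} (hr : 0 < r) {t : ℝ} (ht : 0 ≤ t) : |ramp r t| ≤ r⁻¹ := by
  rw [abs_of_nonneg (ramp_nonneg hr ht), ramp, div_eq_mul_inv]
  exact mul_le_of_le_one_left (inv_nonneg.2 hr.le) (by linarith [Real.exp_pos (-t)])

lemma abs_exp_neg_div_le {r : ℝ} (hr : 0 < r) {t : ℝ} (ht : 0 ≤ t) :
    |Real.exp (-t) / r| ≤ r⁻¹ := by
  rw [abs_of_pos (div_pos (Real.exp_pos _) hr), div_eq_mul_inv]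
  exact mul_le_of_le_one_left (inv_nonneg.2 hr.le) (Real.exp_le_one_iff.2 (by linarith))

/-- One row of the linear system satisfied by the weighted boundary integrals of a saturated
exponential. -/
lemma SatisfiesBAR.sum_boundary_le {d : ℕ} {Γ R : Matrix (Fin d) (Fin d) ℝ} {r : ℝ}
    {π : Measure (Fin d → ℝ)} {ν : Fin d → Measure (Fin d → ℝ)} (h : SatisfiesBAR Γ R r π ν)
    (hZ : ∀ i j, i ≠ j → R i j ≤ 0)
    [IsProbabilityMeasure π] [∀ i, IsProbabilityMeasure (ν i)]
    (hπ : ∀ᵐ z ∂π, z ∈ posOrthant d) (hν : ∀ i, ∀ᵐ z ∂(ν i), z ∈ posOrthant d ∧ z i = 0)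
    (hr0 : 0 < r) (hr1 : r < 1) {c : Fin d → ℝ} (hc0 : ∀ j, 0 ≤ c j) {η U : ℝ}
    (hη0 : 0 < η) (hη1 : η ≤ 1) (hU : 0 ≤ U) (hc : ∀ j, c j ≤ η * (r * U))
    {δ : ℝ} (hδ : 0 < δ) (i : Fin d) :
    ∑ l : Fin d, R i l * (r ^ ((l : ℕ) + 1) * ∫ z, satExp δ (linForm c z) ∂(ν l)) ≤
      η * U * (∑ a, ∑ b, |R a b|) *
          (∑ l : Fin d, r ^ ((l : ℕ) + 1) * ∫ z, satExp δ (linForm c z) ∂(ν l))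
        + r * ((1 + U) ^ 2 * (∑ a, ∑ b, |Γ a b|) + d * ((1 + U) * ∑ a, ∑ b, |R a b|))
          * ∫ z, satExp δ (linForm c z) ∂π := by
  classical
  set RR := ∑ a, ∑ b, |R a b| with hRR
  set GG := ∑ a, ∑ b, |Γ a b| with hGG
  have hRR0 : 0 ≤ RR := Finset.sum_nonneg fun _ _ => Finset.sum_nonneg fun _ _ => abs_nonneg _
  have hGG0 : 0 ≤ GG := Finset.sum_nonneg fun _ _ => Finset.sum_nonneg fun _ _ => abs_nonneg _
  set I := ∫ z, satExp δ (linForm c z) ∂π with hI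
  have hI0 : 0 ≤ I := integral_nonneg fun z => (satExp_pos hδ _).le
  let P : ℝ → ℝ := ramp r
  let P1 : ℝ → ℝ := fun s => Real.exp (-s) / r
  let P2 : ℝ → ℝ := fun s => -Real.exp (-s) / r
  let b : Fin d → ℝ := Pi.single i r
  have hb0 : ∀ j, 0 ≤ b j := fun j => by
    by_cases hj : j = i
    · subst hj; simp [b, hr0.le]
    · simp [b, Pi.single_eq_of_ne hj]
  have hb : ∀ j, |b j| ≤ r := fun j => by
    by_cases hj : j = i
    · subst hj; simp [b, abs_of_pos hr0]
    · simp [b, Pi.single_eq_of_ne hj, hr0.le]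
  have hcη : ∀ j, |c j| ≤ η * (r * U) := fun j => (abs_of_nonneg (hc0 j)).le.trans (hc j)
  have hcr : ∀ j, |c j| ≤ r * U := fun j =>
    (hcη j).trans (mul_le_of_le_one_left (by positivity) hη1)
  have hbz : ∀ z, linForm b z = r * z i := fun z => by
    simp [linForm_apply, b, Pi.single_apply]
  have hub : ∀ l, uR R b l = r * R i l := fun l => by simp [uR, b, Pi.single_apply]
  have dP : ∀ t, HasDerivAt P (P1 t) t := hasDerivAt_ramp r
  have dP1 : ∀ t, HasDerivAt P1 (P2 t) t := fun t => (hasDerivAt_exp_neg t).div_const r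
  have cP : ContDiff ℝ 2 P :=
    (contDiff_const.sub (Real.contDiff_exp.comp contDiff_neg)).div_const r
  have bP : ∀ t, 0 ≤ t → |P t| ≤ r⁻¹ := fun t ht => abs_ramp_le hr0 ht
  have bP1 : ∀ t, 0 ≤ t → |P1 t| ≤ r⁻¹ := fun t ht => abs_exp_neg_div_le hr0 ht
  have bP2 : ∀ t, 0 ≤ t → |P2 t| ≤ r⁻¹ := fun t ht => by
    simpa [P2, neg_div, abs_neg] using abs_exp_neg_div_le hr0 ht
  have dG := hasDerivAt_satExp hδ
  have dG1 := hasDerivAt_satExp1 hδ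
  have bG1 : ∀ t, |satExp1 δ t| ≤ satExp δ t := fun t => by
    rw [abs_of_pos (satExp1_pos hδ t)]
    exact satExp1_le hδ t
  have bG2 : ∀ t, |satExp2 δ t| ≤ satExp δ t := fun t =>
    (abs_satExp2_le hδ t).trans (satExp1_le hδ t)
  have hBr : r⁻¹ ≤ max r⁻¹ δ⁻¹ := le_max_left _ _
  have hBδ : δ⁻¹ ≤ max r⁻¹ δ⁻¹ := le_max_right _ _
  have key := h (ridgeProd P (satExp δ) b c)
    (isC2Bounded_ridgeProd (B := max r⁻¹ δ⁻¹) dP dP1 dG dG1 cP (contDiff_satExp hδ)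
      (fun t ht => (bP t ht).trans hBr) (fun t ht => (bP1 t ht).trans hBr)
      (fun t ht => (bP2 t ht).trans hBr)
      (fun t _ => (abs_satExp_le hδ t).trans hBδ) (fun t _ => (abs_satExp1_le hδ t).trans hBδ)
      (fun t _ => (bG2 t).trans ((satExp_le_inv hδ t).trans hBδ)) hb0 hc0)
  simp only [sum_pd2_ridgeProd dP dP1 dG dG1, sum_pd1_ridgeProd dP dG] at key
  have bound : ∀ {Q G : ℝ → ℝ}, (∀ t, 0 ≤ t → |Q t| ≤ r⁻¹) → (∀ t, |G t| ≤ satExp δ t) →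
      ∀ z ∈ posOrthant d, |ridgeProd Q G b c z| ≤ r⁻¹ * satExp δ (linForm c z) := by
    intro Q G hQ hG z hz
    rw [ridgeProd, abs_mul]
    exact mul_le_mul (hQ _ (linForm_nonneg hb0 hz)) (hG _) (abs_nonneg _) (inv_nonneg.2 hr0.le)
  have bG0 : ∀ t, |satExp δ t| ≤ satExp δ t := fun t => (abs_of_pos (satExp_pos hδ t)).le
  have hT := (linForm c).continuous.measurable
  have hH : |∫ z, (bilin Γ b b * ridgeProd P2 (satExp δ) b c z
      + (bilin Γ b c + bilin Γ c b) * ridgeProd P1 (satExp1 δ) b c z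
      + bilin Γ c c * ridgeProd P (satExp2 δ) b c z) ∂π| ≤ r * ((1 + U) ^ 2 * GG) * I := by
    rw [hI, ← integral_const_mul, ← Real.norm_eq_abs]
    refine norm_integral_le_of_norm_le ((integrable_satExp hδ hT).const_mul _) ?_
    filter_upwards [hπ] with z hz
    rw [Real.norm_eq_abs]
    have q1 := abs_bilin_le Γ hb hb
    have q2 := (abs_add_le (bilin Γ b c) (bilin Γ c b)).trans
      (add_le_add (abs_bilin_le Γ hb hcr) (abs_bilin_le Γ hcr hb))
    have q3 := abs_bilin_le Γ hcr hcr
    have g1 := bound bP2 bG0 z hz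
    have g2 := bound bP1 bG1 z hz
    have g3 := bound bP bG2 z hz
    have hs := satExp_pos hδ (linForm c z)
    calc _ ≤ r * r * GG * (r⁻¹ * satExp δ (linForm c z))
          + (r * (r * U) * GG + r * U * r * GG) * (r⁻¹ * satExp δ (linForm c z))
          + r * U * (r * U) * GG * (r⁻¹ * satExp δ (linForm c z)) := by
          refine (abs_add_three _ _ _).trans ?_
          rw [abs_mul, abs_mul, abs_mul]
          gcongr
      _ = r * ((1 + U) ^ 2 * GG) * satExp δ (linForm c z) := by
          field_simp
          ring
  have hD : ∀ l, |∫ z, (uR R b l * ridgeProd P1 (satExp δ) b c z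
      + uR R c l * ridgeProd P (satExp1 δ) b c z) ∂π| ≤ (1 + U) * RR * I := by
    intro l
    rw [hI, ← integral_const_mul, ← Real.norm_eq_abs]
    refine norm_integral_le_of_norm_le ((integrable_satExp hδ hT).const_mul _) ?_
    filter_upwards [hπ] with z hz
    rw [Real.norm_eq_abs]
    have q1 := abs_uR_le R hb l
    have q2 := abs_uR_le R hcr l
    have g1 := bound bP1 bG0 z hz
    have g2 := bound bP bG1 z hz
    have hs := satExp_pos hδ (linForm c z)
    calc _ ≤ r * RR * (r⁻¹ * satExp δ (linForm c z))
          + r * U * RR * (r⁻¹ * satExp δ (linForm c z)) := by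
          refine (abs_add_le _ _).trans ?_
          rw [abs_mul, abs_mul]
          gcongr
      _ = (1 + U) * RR * satExp δ (linForm c z) := by
          field_simp
  have hN : ∀ l, (R i l - η * U * RR) * ∫ z, satExp δ (linForm c z) ∂(ν l) ≤
      ∫ z, (uR R b l * ridgeProd P1 (satExp δ) b c z
        + uR R c l * ridgeProd P (satExp1 δ) b c z) ∂(ν l) := by
    intro l
    have hνl : ∀ᵐ z ∂(ν l), z ∈ posOrthant d := (hν l).mono fun z hz => hz.1
    rw [← integral_const_mul]
    refine integral_mono_ae ((integrable_satExp hδ hT).const_mul _) ?_ ?_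
    · refine ((integrable_ridgeProd (B := max r⁻¹ δ⁻¹) hνl (by fun_prop) (continuous_satExp hδ)
        (fun t ht => (bP1 t ht).trans hBr) (fun t _ => (abs_satExp_le hδ t).trans hBδ)
        hb0 hc0).const_mul _).add
        ((integrable_ridgeProd (B := max r⁻¹ δ⁻¹) hνl cP.continuous (continuous_satExp1 hδ)
        (fun t ht => (bP t ht).trans hBr) (fun t _ => (abs_satExp1_le hδ t).trans hBδ)
        hb0 hc0).const_mul _)
    · filter_upwards [hν l] with z hz
      have g2 := bound bP bG1 z hz.1
      have q2 := abs_uR_le R hcη l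
      have hs := satExp_pos hδ (linForm c z)
      have h2 : -(η * U * RR * satExp δ (linForm c z)) ≤
          uR R c l * ridgeProd P (satExp1 δ) b c z := by
        refine neg_le_of_abs_le ?_
        rw [abs_mul]
        calc _ ≤ η * (r * U) * RR * (r⁻¹ * satExp δ (linForm c z)) := by gcongr
          _ = _ := by field_simp
      have h1 : R i l * satExp δ (linForm c z) ≤ uR R b l * ridgeProd P1 (satExp δ) b c z := by
        have e : uR R b l * ridgeProd P1 (satExp δ) b c z =
            R i l * (Real.exp (-(r * z i)) * satExp δ (linForm c z)) := by
          simp only [hub, ridgeProd, P1, hbz]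
          field_simp
        rw [e]
        by_cases hil : i = l
        · subst hil
          simp [hz.2]
        · refine mul_le_mul_of_nonpos_left ?_ (hZ i l hil)
          refine mul_le_of_le_one_left hs.le (Real.exp_le_one_iff.2 ?_)
          have := mul_nonneg hr0.le (hz.1 i)
          linarith
      linarith
  set H := ∫ z, (bilin Γ b b * ridgeProd P2 (satExp δ) b c z
      + (bilin Γ b c + bilin Γ c b) * ridgeProd P1 (satExp1 δ) b c z
      + bilin Γ c c * ridgeProd P (satExp2 δ) b c z) ∂π
  have hDs : ∑ l : Fin d, r ^ ((l : ℕ) + 1) * ∫ z, (uR R b l * ridgeProd P1 (satExp δ) b c z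
      + uR R c l * ridgeProd P (satExp1 δ) b c z) ∂π ≤ d * (r * ((1 + U) * RR * I)) := by
    calc _ ≤ ∑ _l : Fin d, r * ((1 + U) * RR * I) := by
          refine Finset.sum_le_sum fun l _ => ?_
          refine (mul_le_mul_of_nonneg_left ((le_abs_self _).trans (hD l))
            (by positivity)).trans ?_
          exact mul_le_mul_of_nonneg_right (pow_le_of_le_one hr0.le hr1.le (by omega))
            (by positivity)
      _ = _ := by simp
  have hNs : ∑ l : Fin d, r ^ ((l : ℕ) + 1) *
      ((R i l - η * U * RR) * ∫ z, satExp δ (linForm c z) ∂(ν l)) ≤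
      ∑ l : Fin d, r ^ ((l : ℕ) + 1) * ∫ z, (uR R b l * ridgeProd P1 (satExp δ) b c z
        + uR R c l * ridgeProd P (satExp1 δ) b c z) ∂(ν l) :=
    Finset.sum_le_sum fun l _ => mul_le_mul_of_nonneg_left (hN l) (by positivity)
  clear_value RR GG
  have e : ∑ l : Fin d, r ^ ((l : ℕ) + 1) *
      ((R i l - η * U * RR) * ∫ z, satExp δ (linForm c z) ∂(ν l)) =
      ∑ l : Fin d, R i l * (r ^ ((l : ℕ) + 1) * ∫ z, satExp δ (linForm c z) ∂(ν l))
      - η * U * RR * ∑ l : Fin d, r ^ ((l : ℕ) + 1) * ∫ z, satExp δ (linForm c z) ∂(ν l) := by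
    rw [Finset.mul_sum, ← Finset.sum_sub_distrib]
    exact Finset.sum_congr rfl fun l _ => by ring
  have hH' := neg_le_of_abs_le hH
  have hpos : 0 ≤ r * ((1 + U) ^ 2 * GG) * I := by positivity
  rw [e] at hNs
  linarith

/-- Exponential moments of the boundary measures are controlled by those of the stationary
measure. -/
lemma SatisfiesBAR.boundary_integral_exp_le {d : ℕ} {Γ R : Matrix (Fin d) (Fin d) ℝ} {r : ℝ}
    {π : Measure (Fin d → ℝ)} {ν : Fin d → Measure (Fin d → ℝ)} (h : SatisfiesBAR Γ R r π ν)
    (hZ : ∀ i j, i ≠ j → R i j ≤ 0)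
    [IsProbabilityMeasure π] [∀ i, IsProbabilityMeasure (ν i)]
    (hπ : ∀ᵐ z ∂π, z ∈ posOrthant d) (hν : ∀ i, ∀ᵐ z ∂(ν i), z ∈ posOrthant d ∧ z i = 0)
    (hr0 : 0 < r) (hr1 : r < 1) {c : Fin d → ℝ} (hc0 : ∀ j, 0 ≤ c j) {η U : ℝ}
    (hη0 : 0 < η) (hη1 : η ≤ 1) (hU : 0 ≤ U) (hc : ∀ j, c j ≤ η * (r * U))
    {p : Fin d → ℝ} (hp0 : ∀ j, 0 ≤ p j) (hp : ∀ l, ∑ j, p j * R j l = 1)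
    (hsmall : (∑ j, p j) * (η * U * ∑ a, ∑ b, |R a b|) ≤ 1 / 2)
    (hint : Integrable (fun z => Real.exp (linForm c z)) π)
    {K : ℝ} (hK : ∫ z, Real.exp (linForm c z) ∂π ≤ K) (l : Fin d) :
    Integrable (fun z => Real.exp (linForm c z)) (ν l) ∧
      r ^ (l : ℕ) * ∫ z, Real.exp (linForm c z) ∂(ν l) ≤
        2 * ((∑ j, p j) * (((1 + U) ^ 2 * (∑ a, ∑ b, |Γ a b|)
          + d * ((1 + U) * ∑ a, ∑ b, |R a b|)) * K)) := by
  have hrow := fun {δ : ℝ} (hδ : 0 < δ) => h.sum_boundary_le hZ hπ hν hr0 hr1 hc0 hη0 hη1 hU hc hδ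
  have hRR0 : 0 ≤ ∑ a, ∑ b, |R a b| :=
    Finset.sum_nonneg fun _ _ => Finset.sum_nonneg fun _ _ => abs_nonneg _
  have hGG0 : 0 ≤ ∑ a, ∑ b, |Γ a b| :=
    Finset.sum_nonneg fun _ _ => Finset.sum_nonneg fun _ _ => abs_nonneg _
  generalize ∑ a, ∑ b, |R a b| = RR at *
  generalize ∑ a, ∑ b, |Γ a b| = GG at *
  obtain ⟨C0, hC0⟩ : ∃ C0, C0 = (1 + U) ^ 2 * GG + d * ((1 + U) * RR) := ⟨_, rfl⟩
  have hC0n : 0 ≤ C0 := by rw [hC0]; positivity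
  rw [← hC0] at hrow ⊢
  have hP0 : 0 ≤ ∑ j, p j := Finset.sum_nonneg fun j _ => hp0 j
  have hT := (linForm c).continuous.measurable
  have hrl : 0 < r ^ (l : ℕ) := by positivity
  rw [mul_comm, ← le_div_iff₀ hrl]
  refine integral_exp_le_of_satExp1 (ν l) hT fun δ hδ => ?_
  rw [le_div_iff₀ hrl]
  obtain ⟨J, hJ⟩ : ∃ J : Fin d → ℝ,
      J = fun l : Fin d => r ^ ((l : ℕ) + 1) * ∫ z, satExp δ (linForm c z) ∂(ν l) := ⟨_, rfl⟩
  have hJ' : ∀ l : Fin d, r ^ ((l : ℕ) + 1) * ∫ z, satExp δ (linForm c z) ∂(ν l) = J l := fun l => by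
    rw [hJ]
  have hJ0 : ∀ l, 0 ≤ J l := fun l => by
    rw [hJ]
    exact mul_nonneg (by positivity) (integral_nonneg fun z => (satExp_pos hδ _).le)
  have hI : ∫ z, satExp δ (linForm c z) ∂π ≤ K :=
    (integral_mono (integrable_satExp hδ hT) hint fun z => satExp_le_exp hδ _).trans hK
  have hrow' := hrow hδ
  simp only [hJ'] at hrow'
  have hsum : ∑ l, J l = ∑ i, p i * ∑ l, R i l * J l := by
    simp only [Finset.mul_sum]
    rw [Finset.sum_comm]
    refine Finset.sum_congr rfl fun l _ => ?_
    simp only [← mul_assoc, ← Finset.sum_mul, hp, one_mul]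
  have hS0 : 0 ≤ ∑ l, J l := Finset.sum_nonneg fun l _ => hJ0 l
  have hS : ∑ l, J l ≤ (∑ j, p j) * (η * U * RR * ∑ l, J l + r * C0 * K) := by
    rw [Finset.sum_mul]
    nth_rw 1 [hsum]
    refine Finset.sum_le_sum fun i _ => mul_le_mul_of_nonneg_left ((hrow' i).trans ?_) (hp0 i)
    gcongr
  have hS2 : ∑ l, J l ≤ 2 * ((∑ j, p j) * (r * C0 * K)) := by
    nlinarith [mul_le_mul_of_nonneg_right hsmall hS0]
  have hl : J l ≤ ∑ l, J l := Finset.single_le_sum (fun l _ => hJ0 l) (Finset.mem_univ l)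
  have h1 : ∫ z, satExp1 δ (linForm c z) ∂(ν l) ≤ ∫ z, satExp δ (linForm c z) ∂(ν l) :=
    integral_mono (integrable_satExp1 hδ hT) (integrable_satExp hδ hT) fun z => satExp1_le hδ _
  refine le_of_mul_le_mul_left ?_ hr0
  calc r * ((∫ z, satExp1 δ (linForm c z) ∂(ν l)) * r ^ (l : ℕ))
      = r ^ ((l : ℕ) + 1) * ∫ z, satExp1 δ (linForm c z) ∂(ν l) := by ring
    _ ≤ J l := by rw [← hJ' l]; gcongr
    _ ≤ _ := hl.trans (hS2.trans (le_of_eq (by ring)))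

lemma exists_exp_le_add_pow_mul_exp {s η : ℝ} (hs : 0 ≤ s) (hη : 0 < η) (n : ℕ) :
    ∃ K > 0, ∃ ρ > 0, ∀ r ∈ Set.Ioo (0 : ℝ) ρ, ∀ y, 0 ≤ y →
      Real.exp (s * r * y) ≤ K + K * (r ^ n * Real.exp (η * y)) := by
  obtain ⟨L, hL⟩ : ∃ L, L = (n.factorial : ℝ) / (η / 2) ^ n := ⟨_, rfl⟩
  have hL0 : 0 < L := by rw [hL]; positivity
  refine ⟨Real.exp s + L, by positivity, η / (2 * (s + 1)), by positivity, ?_⟩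
  rintro r ⟨hr0, hr⟩ y hy
  have hE := Real.exp_pos s
  have hF : 0 < r ^ n * Real.exp (η * y) := by positivity
  rcases le_total (r * y) 1 with h | h
  · have : Real.exp (s * r * y) ≤ Real.exp s := by
      rw [Real.exp_le_exp]
      nlinarith
    nlinarith [mul_pos (add_pos hE hL0) hF]
  · have h1 : Real.exp (s * r * y) ≤ Real.exp (η / 2 * y) := by
      rw [Real.exp_le_exp]
      refine mul_le_mul_of_nonneg_right ?_ hy
      rw [lt_div_iff₀ (by positivity)] at hr
      nlinarith
    have h2 : (η / 2) ^ n / n.factorial ≤ r ^ n * Real.exp (η / 2 * y) := by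
      calc (η / 2) ^ n / n.factorial ≤ (η / 2) ^ n / n.factorial * (r * y) ^ n :=
            le_mul_of_one_le_right (by positivity) (one_le_pow₀ h)
        _ = r ^ n * ((η / 2 * y) ^ n / n.factorial) := by ring
        _ ≤ _ := mul_le_mul_of_nonneg_left
            (Real.pow_div_factorial_le_exp _ (by positivity) n) (by positivity)
    have h3 : 1 ≤ L * (r ^ n * Real.exp (η / 2 * y)) := by
      calc (1 : ℝ) = L * ((η / 2) ^ n / n.factorial) := by rw [hL]; field_simp
        _ ≤ _ := mul_le_mul_of_nonneg_left h2 hL0.le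
    have h4 : Real.exp (η * y) = Real.exp (η / 2 * y) * Real.exp (η / 2 * y) := by
      rw [← Real.exp_add]
      ring_nf
    calc Real.exp (s * r * y) ≤ Real.exp (η / 2 * y) := h1
      _ ≤ L * (r ^ n * Real.exp (η / 2 * y)) * Real.exp (η / 2 * y) :=
          le_mul_of_one_le_left (Real.exp_pos _).le h3
      _ = L * (r ^ n * Real.exp (η * y)) := by rw [h4]; ring
      _ ≤ _ := by nlinarith [mul_pos hE hF]

lemma integral_exp_le_add {α : Type*} [MeasurableSpace α] {μ : Measure α} {f g h : α → ℝ}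
    (hf : Integrable (fun z => Real.exp (f z)) μ) (hg : Integrable (fun z => Real.exp (g z)) μ)
    (hm : Measurable h) (hle : ∀ᵐ z ∂μ, 2 * h z ≤ f z + g z) :
    Integrable (fun z => Real.exp (h z)) μ ∧
      ∫ z, Real.exp (h z) ∂μ ≤ ∫ z, Real.exp (f z) ∂μ + ∫ z, Real.exp (g z) ∂μ := by
  have hb : ∀ᵐ z ∂μ, Real.exp (h z) ≤ Real.exp (f z) + Real.exp (g z) := by
    filter_upwards [hle] with z hz
    rcases le_total (f z) (g z) with hfg | hfg
    · linarith [Real.exp_pos (f z), Real.exp_le_exp.2 (show h z ≤ g z by linarith)]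
    · linarith [Real.exp_pos (g z), Real.exp_le_exp.2 (show h z ≤ f z by linarith)]
  have hI : Integrable (fun z => Real.exp (h z)) μ :=
    (hf.add hg).mono' (Real.measurable_exp.comp hm).aestronglyMeasurable <| by
      filter_upwards [hb] with z hz
      rwa [Real.norm_eq_abs, abs_of_pos (Real.exp_pos _)]
  refine ⟨hI, ?_⟩
  rw [← integral_add hf hg]
  exact integral_mono_ae hI (hf.add hg) hb

/-- The partial sum `∑_{j < m} r ^ (j + 1) * z j` of scaled coordinates. -/
def scaledSum {d : ℕ} (m : ℕ) (r : ℝ) (z : Fin d → ℝ) : ℝ :=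
  ∑ j : Fin d, if (j : ℕ) < m then r ^ ((j : ℕ) + 1) * z j else 0

lemma measurable_scaledSum {d : ℕ} (m : ℕ) (r : ℝ) :
    Measurable (scaledSum (d := d) m r) := by
  unfold scaledSum
  refine Finset.measurable_sum _ fun j _ => ?_
  split_ifs <;> fun_prop

lemma scaledSum_nonneg {d : ℕ} (m : ℕ) {r : ℝ} (hr : 0 ≤ r) {z : Fin d → ℝ}
    (hz : z ∈ posOrthant d) : 0 ≤ scaledSum m r z := by
  refine Finset.sum_nonneg fun j _ => ?_
  have := hz j
  split_ifs <;> positivity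

lemma scaledSum_succ {d : ℕ} (k : Fin d) (r : ℝ) (z : Fin d → ℝ) :
    scaledSum ((k : ℕ) + 1) r z = scaledSum k r z + r ^ ((k : ℕ) + 1) * z k := by
  classical
  have : r ^ ((k : ℕ) + 1) * z k =
      ∑ j : Fin d, if j = k then r ^ ((j : ℕ) + 1) * z j else 0 := by simp
  rw [this, scaledSum, scaledSum, ← Finset.sum_add_distrib]
  refine Finset.sum_congr rfl fun j _ => ?_
  rcases lt_trichotomy j k with h | rfl | h
  · have h' : (j : ℕ) < k := h
    simp [h', h.ne, h'.trans (Nat.lt_succ_self _)]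
  · simp
  · have h' : (k : ℕ) < j := h
    simp [h.ne', show ¬ (j : ℕ) < k by omega, show ¬ (j : ℕ) < k + 1 by omega]

lemma le_scaledSum {d : ℕ} (k : Fin d) {r : ℝ} (hr : 0 ≤ r) {z : Fin d → ℝ}
    (hz : z ∈ posOrthant d) : r ^ ((k : ℕ) + 1) * z k ≤ scaledSum d r z := by
  have h := Finset.single_le_sum (s := Finset.univ)
    (f := fun j : Fin d => if (j : ℕ) < d then r ^ ((j : ℕ) + 1) * z j else 0)
    (fun j _ => by have := hz j; split_ifs <;> positivity) (Finset.mem_univ k)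
  simpa [scaledSum] using h

/-- Uniform exponential moment bounds for the first `m` scaled coordinates. -/
def ExpMomentBound {d : ℕ} (π : ℝ → Measure (Fin d → ℝ)) (ν : Fin d → ℝ → Measure (Fin d → ℝ))
    (m : ℕ) : Prop :=
  ∃ η > (0 : ℝ), ∃ r₀ ∈ Set.Ioc (0 : ℝ) 1, ∃ C : ℝ, ∀ r ∈ Set.Ioo (0 : ℝ) r₀,
    (Integrable (fun z => Real.exp (η * scaledSum m r z)) (π r) ∧
      ∫ z, Real.exp (η * scaledSum m r z) ∂(π r) ≤ C) ∧
    ∀ i, Integrable (fun z => Real.exp (η * scaledSum m r z)) (ν i r) ∧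
      r ^ (i : ℕ) * ∫ z, Real.exp (η * scaledSum m r z) ∂(ν i r) ≤ C

lemma BARFamily.ae_posOrthant {d : ℕ} {Γ R : Matrix (Fin d) (Fin d) ℝ}
    {π : ℝ → Measure (Fin d → ℝ)} {ν : Fin d → ℝ → Measure (Fin d → ℝ)}
    (h : BARFamily Γ R π ν) {r : ℝ} (hr : r ∈ Set.Ioo (0 : ℝ) 1) :
    ∀ᵐ z ∂(π r), z ∈ posOrthant d := by
  have := (h r hr).1
  have hm : MeasurableSet (posOrthant d) := by
    simp only [posOrthant, Set.ofPred_forall]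
    exact MeasurableSet.iInter fun i => measurableSet_le measurable_const (measurable_pi_apply i)
  exact (mem_ae_iff_prob_eq_one hm).2 (h r hr).2.1

lemma BARFamily.ae_face {d : ℕ} {Γ R : Matrix (Fin d) (Fin d) ℝ}
    {π : ℝ → Measure (Fin d → ℝ)} {ν : Fin d → ℝ → Measure (Fin d → ℝ)}
    (h : BARFamily Γ R π ν) {r : ℝ} (hr : r ∈ Set.Ioo (0 : ℝ) 1) (i : Fin d) :
    ∀ᵐ z ∂(ν i r), z ∈ posOrthant d ∧ z i = 0 := by
  have := ((h r hr).2.2.1 i).1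
  have hm : MeasurableSet {z | z ∈ posOrthant d ∧ z i = 0} := by
    simp only [posOrthant, Set.ofPred_forall, Set.ofPred_and]
    exact (MeasurableSet.iInter fun i => measurableSet_le measurable_const
      (measurable_pi_apply i)).inter
        (measurableSet_eq_fun (measurable_pi_apply i) measurable_const)
  exact (mem_ae_iff_prob_eq_one hm).2 ((h r hr).2.2.1 i).2

lemma BARFamily.expMomentBound_zero {d : ℕ} {Γ R : Matrix (Fin d) (Fin d) ℝ}
    {π : ℝ → Measure (Fin d → ℝ)} {ν : Fin d → ℝ → Measure (Fin d → ℝ)}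
    (h : BARFamily Γ R π ν) : ExpMomentBound π ν 0 := by
  refine ⟨1, one_pos, 1, ⟨one_pos, le_rfl⟩, 1, fun r hr => ?_⟩
  obtain ⟨hπ, -, hν, -⟩ := h r hr
  have h0 : ∀ z : Fin d → ℝ, scaledSum 0 r z = 0 := fun z => by simp [scaledSum]
  refine ⟨by simp [h0], fun i => ?_⟩
  have := (hν i).1
  simpa [h0] using pow_le_one₀ hr.1.le hr.2.le

lemma linForm_direction_le {d : ℕ} {k : Fin d} {u : Fin d → ℝ} (hu : ∀ j, 0 ≤ u j)
    (hgt : ∀ j, k < j → u j = 0) {η r : ℝ} (hη : 0 ≤ η) (hr0 : 0 ≤ r) (hr1 : r ≤ 1)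
    {z : Fin d → ℝ} (hz : z ∈ posOrthant d) (hzk : z k = 0) :
    linForm (fun j => η * r ^ ((k : ℕ) + 1) * u j) z ≤
      η * (∑ j, u j) * r * scaledSum k r z := by
  rw [linForm_apply, scaledSum, Finset.mul_sum]
  refine Finset.sum_le_sum fun j _ => ?_
  rcases lt_trichotomy j k with h | rfl | h
  · have h' : (j : ℕ) < k := h
    rw [if_pos h']
    have h1 : r ^ ((k : ℕ) + 1) ≤ r * r ^ ((j : ℕ) + 1) := by
      rw [← pow_succ']
      exact pow_le_pow_of_le_one hr0 hr1 (by omega)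
    have h2 : u j ≤ ∑ j, u j := Finset.single_le_sum (fun j _ => hu j) (Finset.mem_univ j)
    have h3 := hz j
    have h4 := hu j
    calc η * r ^ ((k : ℕ) + 1) * u j * z j
        ≤ η * (r * r ^ ((j : ℕ) + 1)) * (∑ j, u j) * z j := by gcongr
      _ = _ := by ring
  · simp [hzk]
  · have h' : ¬ (j : ℕ) < k := not_lt.2 (le_of_lt h)
    simp [hgt j h, h']

lemma le_linForm_direction {d : ℕ} {k : Fin d} {u : Fin d → ℝ} (hu : ∀ j, 0 ≤ u j)
    {η r : ℝ} (hη : 0 ≤ η) (hr0 : 0 ≤ r) {z : Fin d → ℝ} (hz : z ∈ posOrthant d) :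
    η * u k * (r ^ ((k : ℕ) + 1) * z k) ≤
      linForm (fun j => η * r ^ ((k : ℕ) + 1) * u j) z := by
  rw [linForm_apply]
  refine le_trans (le_of_eq (by ring)) (Finset.single_le_sum
    (f := fun j => η * r ^ ((k : ℕ) + 1) * u j * z j) (fun j _ => ?_) (Finset.mem_univ k))
  have := hu j
  have := hz j
  positivity

lemma BARFamily.expMomentBound_succ {d : ℕ} {Γ R : Matrix (Fin d) (Fin d) ℝ}
    (hR : IsMMatrix R) {π : ℝ → Measure (Fin d → ℝ)} {ν : Fin d → ℝ → Measure (Fin d → ℝ)}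
    (h : BARFamily Γ R π ν) (k : Fin d) (hk : ExpMomentBound π ν k) :
    ExpMomentBound π ν ((k : ℕ) + 1) := by
  obtain ⟨η₁, hη₁, r₁, ⟨hr₁0, hr₁1⟩, C, hC⟩ := hk
  obtain ⟨u, hu, hukpos, hugt, huk, hlt, hgt⟩ := hR.exists_direction k
  obtain ⟨p, hp0, -, hp⟩ := hR.exists_nonneg_solution Finset.univ (fun _ => 1) fun _ => zero_le_one
  have hp' : ∀ l, ∑ j, p j * R j l = 1 := fun l => hp l (Finset.mem_univ l)
  set U := ∑ j, u j with hU
  have hU0 : 0 ≤ U := Finset.sum_nonneg fun j _ => hu j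
  have hP0 : 0 ≤ ∑ j, p j := Finset.sum_nonneg fun j _ => hp0 j
  have hRR0 : 0 ≤ ∑ a, ∑ b, |R a b| :=
    Finset.sum_nonneg fun _ _ => Finset.sum_nonneg fun _ _ => abs_nonneg _
  have hS0 : 0 ≤ ∑ l, |uR R u l| := Finset.sum_nonneg fun _ _ => abs_nonneg _
  set D := 1 + |bilin Γ u u| + (∑ j, p j) * (U * ∑ a, ∑ b, |R a b|) with hD
  have hPU : 0 ≤ (∑ j, p j) * (U * ∑ a, ∑ b, |R a b|) := by positivity
  have hq0 := abs_nonneg (bilin Γ u u)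
  have hD1 : 1 ≤ D := by linarith
  obtain ⟨η, hη⟩ : ∃ η, η = 1 / (2 * D) := ⟨_, rfl⟩
  have hη0 : 0 < η := by rw [hη]; positivity
  have hηD : η * D = 1 / 2 := by rw [hη]; field_simp
  have hη1 : η ≤ 1 := by nlinarith
  have hηq : η * |bilin Γ u u| ≤ 1 / 2 := by nlinarith
  have hηp : (∑ j, p j) * (η * U * ∑ a, ∑ b, |R a b|) ≤ 1 / 2 := by nlinarith
  obtain ⟨K, hK, ρ, hρ, hKρ⟩ := exists_exp_le_add_pow_mul_exp (s := η * U) (by positivity) hη₁ k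
  obtain ⟨K1, hK1⟩ : ∃ K1, K1 = 2 * (K + K * C) := ⟨_, rfl⟩
  obtain ⟨K2, hK2⟩ : ∃ K2, K2 = 2 * ((∑ j, p j) * (((1 + U) ^ 2 * (∑ a, ∑ b, |Γ a b|)
      + d * ((1 + U) * ∑ a, ∑ b, |R a b|)) * K1)) := ⟨_, rfl⟩
  obtain ⟨η₂, hη₂⟩ : ∃ η₂, η₂ = min η₁ (η * u k) / 2 := ⟨_, rfl⟩
  have hη₂0 : 0 < η₂ := by rw [hη₂]; positivity
  have hη₂1 : 2 * η₂ ≤ η₁ := by rw [hη₂]; linarith [min_le_left η₁ (η * u k)]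
  have hη₂2 : 2 * η₂ ≤ η * u k := by rw [hη₂]; linarith [min_le_right η₁ (η * u k)]
  refine ⟨η₂, hη₂0, min r₁ (min ρ (1 / (4 * (1 + ∑ l, |uR R u l|)))),
    ⟨by positivity, (min_le_left _ _).trans hr₁1⟩, C + max K1 K2, ?_⟩
  rintro r ⟨hr0, hr⟩
  rw [lt_min_iff, lt_min_iff, lt_div_iff₀ (by positivity)] at hr
  obtain ⟨hrr₁, hrρ, hrS⟩ := hr
  have hr1 : r < 1 := hrr₁.trans_le hr₁1
  have hrI : r ∈ Set.Ioo (0 : ℝ) 1 := ⟨hr0, hr1⟩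
  obtain ⟨hπp, -, hνp, hbar⟩ := h r hrI
  have hνp' : ∀ i, IsProbabilityMeasure (ν i r) := fun i => (hνp i).1
  have hπ := h.ae_posOrthant hrI
  have hν := h.ae_face hrI
  obtain ⟨⟨hCπ, hCπ'⟩, hCν⟩ := hC r ⟨hr0, hrr₁⟩
  set c : Fin d → ℝ := fun j => η * r ^ ((k : ℕ) + 1) * u j with hc
  have hc0 : ∀ j, 0 ≤ c j := fun j => by have := hu j; simp only [hc]; positivity
  have hcU : ∀ j, c j ≤ η * (r * U) := fun j => by
    have h1 : u j ≤ U := Finset.single_le_sum (fun j _ => hu j) (Finset.mem_univ j)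
    have h2 : r ^ ((k : ℕ) + 1) ≤ r := pow_le_of_le_one hr0.le hr1.le (by omega)
    have := hu j
    change η * r ^ ((k : ℕ) + 1) * u j ≤ η * (r * U)
    rw [mul_assoc]
    gcongr
  have hT := (linForm c).continuous.measurable
  have hface : ∀ δ, 0 < δ → ∫ z, satExp1 δ (linForm c z) ∂(ν k r) ≤ K + K * C := by
    intro δ hδ
    have hrhs : Integrable (fun z => K + K * (r ^ (k : ℕ) *
        Real.exp (η₁ * scaledSum k r z))) (ν k r) :=
      (integrable_const K).add (((hCν k).1.const_mul _).const_mul _)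
    calc ∫ z, satExp1 δ (linForm c z) ∂(ν k r)
        ≤ ∫ z, (K + K * (r ^ (k : ℕ) * Real.exp (η₁ * scaledSum k r z))) ∂(ν k r) := by
          refine integral_mono_ae (integrable_satExp1 hδ hT) hrhs ?_
          filter_upwards [hν k] with z hz
          refine (satExp1_le hδ _).trans ((satExp_le_exp hδ _).trans (le_trans ?_
            (hKρ r ⟨hr0, hrρ⟩ _ (scaledSum_nonneg k hr0.le hz.1))))
          exact Real.exp_le_exp.2 (linForm_direction_le hu hugt hη0.le hr0.le hr1.le hz.1 hz.2)
      _ = K + K * (r ^ (k : ℕ) * ∫ z, Real.exp (η₁ * scaledSum k r z) ∂(ν k r)) := by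
          rw [integral_add (integrable_const K) (((hCν k).1.const_mul _).const_mul _),
            integral_const_mul, integral_const_mul]
          simp
      _ ≤ K + K * C := by
          have := (hCν k).2
          gcongr
  obtain ⟨hE, hE'⟩ := integral_exp_le_of_satExp1 (π r) hT (C := K1) fun δ hδ => by
    have h1 := hbar.integral_satExp1_le hr0 hr1 hu huk hlt hgt hη0 hηq (by nlinarith) hδ
    have h2 := hface δ hδ
    rw [hK1]
    exact h1.trans (by linarith)
  have hB := hbar.boundary_integral_exp_le hR.1 hπ hν hr0 hr1 hc0 hη0 hη1 hU0 hcU hp0 hp' hηp hE hE'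
  rw [← hK2] at hB
  have hle : ∀ z ∈ posOrthant d, 2 * (η₂ * scaledSum ((k : ℕ) + 1) r z) ≤
      η₁ * scaledSum k r z + linForm c z := by
    intro z hz
    rw [scaledSum_succ]
    have h1 := le_linForm_direction (k := k) hu hη0.le hr0.le hz
    have h2 := mul_le_mul_of_nonneg_right hη₂1 (scaledSum_nonneg k hr0.le hz)
    have h3 := mul_le_mul_of_nonneg_right hη₂2
      (mul_nonneg (pow_nonneg hr0.le ((k : ℕ) + 1)) (hz k))
    linarith
  have hm : Measurable fun z : Fin d → ℝ => η₂ * scaledSum ((k : ℕ) + 1) r z :=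
    (measurable_scaledSum _ r).const_mul η₂
  refine ⟨?_, fun i => ?_⟩
  · obtain ⟨h1, h2⟩ := integral_exp_le_add hCπ hE hm (hπ.mono hle)
    exact ⟨h1, h2.trans (by linarith [le_max_left K1 K2])⟩
  · obtain ⟨h1, h2⟩ := integral_exp_le_add (hCν i).1 (hB i).1 hm
      ((hν i).mono fun z hz => hle z hz.1)
    refine ⟨h1, (mul_le_mul_of_nonneg_left h2 (pow_nonneg hr0.le _)).trans ?_⟩
    rw [mul_add]
    linarith [(hCν i).2, (hB i).2, le_max_right K1 K2]

lemma BARFamily.expMomentBound {d : ℕ} {Γ R : Matrix (Fin d) (Fin d) ℝ}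
    (hR : IsMMatrix R) {π : ℝ → Measure (Fin d → ℝ)} {ν : Fin d → ℝ → Measure (Fin d → ℝ)}
    (h : BARFamily Γ R π ν) : ExpMomentBound π ν d := by
  have : ∀ m ≤ d, ExpMomentBound π ν m := by
    intro m
    induction m with
    | zero => exact fun _ => h.expMomentBound_zero
    | succ m ih => exact fun hm => h.expMomentBound_succ hR ⟨m, hm⟩ (ih (by omega))
  exact this d le_rfl

lemma integral_scaled_pow_le {d : ℕ} {μ : Measure (Fin d → ℝ)}
    (hμ : ∀ᵐ z ∂μ, z ∈ posOrthant d) {η r : ℝ} (hη : 0 < η) (hr : 0 ≤ r)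
    (hint : Integrable (fun z => Real.exp (η * scaledSum d r z)) μ) (k : Fin d) (n : ℕ) :
    Integrable (fun z => (r ^ ((k : ℕ) + 1) * z k) ^ n) μ ∧
      ∫ z, (r ^ ((k : ℕ) + 1) * z k) ^ n ∂μ ≤
        n.factorial / η ^ n * ∫ z, Real.exp (η * scaledSum d r z) ∂μ := by
  have hb : ∀ᵐ z ∂μ, (r ^ ((k : ℕ) + 1) * z k) ^ n ≤
      n.factorial / η ^ n * Real.exp (η * scaledSum d r z) := by
    filter_upwards [hμ] with z hz
    have h0 : 0 ≤ r ^ ((k : ℕ) + 1) * z k := mul_nonneg (by positivity) (hz k)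
    have hW := scaledSum_nonneg d hr hz
    calc (r ^ ((k : ℕ) + 1) * z k) ^ n ≤ scaledSum d r z ^ n := by
          gcongr
          exact le_scaledSum k hr hz
      _ = n.factorial / η ^ n * ((η * scaledSum d r z) ^ n / n.factorial) := by
          rw [mul_pow]
          field_simp
      _ ≤ _ := mul_le_mul_of_nonneg_left
          (Real.pow_div_factorial_le_exp _ (by positivity) n) (by positivity)
  have hI : Integrable (fun z => (r ^ ((k : ℕ) + 1) * z k) ^ n) μ := by
    refine (hint.const_mul (n.factorial / η ^ n)).mono'
      (show Measurable _ by fun_prop).aestronglyMeasurable ?_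
    filter_upwards [hb, hμ] with z hz hz'
    rwa [Real.norm_eq_abs, abs_of_nonneg (pow_nonneg (mul_nonneg (by positivity) (hz' k)) n)]
  refine ⟨hI, ?_⟩
  rw [← integral_const_mul]
  exact integral_mono_ae hI (hint.const_mul _) hb

/-- Uniform polynomial moment bounds for the scaled coordinates. -/
lemma BARFamily.exists_moment_bound {d : ℕ} {Γ R : Matrix (Fin d) (Fin d) ℝ}
    (hR : IsMMatrix R) {π : ℝ → Measure (Fin d → ℝ)} {ν : Fin d → ℝ → Measure (Fin d → ℝ)}
    (h : BARFamily Γ R π ν) :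
    ∃ r₀ ∈ Set.Ioc (0 : ℝ) 1, ∀ n : ℕ, ∃ C : ℝ, ∀ k : Fin d, ∀ r ∈ Set.Ioo (0 : ℝ) r₀,
      ∫ z, (r ^ ((k : ℕ) + 1) * z k) ^ n ∂(π r) ≤ C ∧
      ∀ i : Fin d, Integrable (fun z => (r ^ ((k : ℕ) + 1) * z k) ^ n) (ν i r) ∧
        r ^ (i : ℕ) * ∫ z, (r ^ ((k : ℕ) + 1) * z k) ^ n ∂(ν i r) ≤ C := by
  obtain ⟨η, hη, r₀, hr₀, C, hC⟩ := h.expMomentBound hR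
  refine ⟨r₀, hr₀, fun n => ⟨n.factorial / η ^ n * C, fun k r hr => ?_⟩⟩
  have hrI : r ∈ Set.Ioo (0 : ℝ) 1 := ⟨hr.1, hr.2.trans_le hr₀.2⟩
  obtain ⟨⟨hπ, hπ'⟩, hν⟩ := hC r hr
  have hN : 0 ≤ n.factorial / η ^ n := by positivity
  refine ⟨(integral_scaled_pow_le (h.ae_posOrthant hrI) hη hr.1.le hπ k n).2.trans
    (mul_le_mul_of_nonneg_left hπ' hN), fun i => ?_⟩
  obtain ⟨h1, h2⟩ := integral_scaled_pow_le ((h.ae_face hrI i).mono fun z hz => hz.1) hη hr.1.le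
    (hν i).1 k n
  refine ⟨h1, (mul_le_mul_of_nonneg_left h2 (pow_nonneg hr.1.le _)).trans ?_⟩
  rw [mul_left_comm]
  exact mul_le_mul_of_nonneg_left (hν i).2 hN

lemma mul_le_sqrt_add_pow {r y : ℝ} (hr : 0 ≤ r) (hy : 0 ≤ y) (i : ℕ) :
    r * y ≤ √r + r * (r ^ i * y ^ (2 * i + 1)) := by
  have hq := Real.sqrt_nonneg r
  have hqq : √r * √r = r := Real.mul_self_sqrt hr
  have hw : 0 ≤ √r * y := mul_nonneg hq hy
  have h1 : √r * y ≤ 1 + (√r * y) ^ (2 * i + 1) := by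
    rcases le_total (√r * y) 1 with h | h
    · linarith [pow_nonneg hw (2 * i + 1)]
    · linarith [le_self_pow₀ h (show 2 * i + 1 ≠ 0 by omega)]
  calc r * y = √r * (√r * y) := by rw [← mul_assoc, hqq]
    _ ≤ √r * (1 + (√r * y) ^ (2 * i + 1)) := mul_le_mul_of_nonneg_left h1 hq
    _ = √r + (√r * √r) * ((√r * √r) ^ i * y ^ (2 * i + 1)) := by ring
    _ = _ := by rw [hqq]

/-- Uniform moment bounds for an M-reflection matrix: all moments
of `r^k Z_k` under `π r` and the weighted moments under the boundary measures are
uniformly bounded on `(0, r₀)`; in particular the uniform moment bound condition holds. -/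
theorem uniform_moment_bounds_M
    {d : ℕ} (hd : 1 ≤ d)
    (Γ R : Matrix (Fin d) (Fin d) ℝ)
    (hΓsymm : Γ.IsSymm) (hΓpd : Γ.PosDef)
    (hR : IsMMatrix R)
    (π : ℝ → Measure (Fin d → ℝ)) (ν : Fin d → ℝ → Measure (Fin d → ℝ))
    (hBAR : BARFamily Γ R π ν) :
    (∃ r₀ ∈ Set.Ioc (0 : ℝ) 1, ∀ k : Fin d, ∀ n : ℕ,
      ∃ C : ℝ, ∃ Cb : Fin d → ℝ, ∀ r ∈ Set.Ioo (0 : ℝ) r₀,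
        (∫ z, (r ^ ((k : ℕ) + 1) * z k) ^ n ∂(π r)) < C ∧
        ∀ i : Fin d,
          r ^ (i : ℕ) * (∫ z, (r ^ ((k : ℕ) + 1) * z k) ^ n ∂(ν i r)) < Cb i) ∧
    UniformMomentBound π ν := by
  obtain ⟨r₀, hr₀, hM⟩ := hBAR.exists_moment_bound hR
  refine ⟨⟨r₀, hr₀, fun k n => ?_⟩, fun i k => ⟨⟨r₀, hr₀.1, ?_⟩, ?_⟩⟩
  · obtain ⟨C, hC⟩ := hM n
    refine ⟨C + 1, fun _ => C + 1, fun r hr => ⟨?_, fun i => ?_⟩⟩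
    · linarith [(hC k r hr).1]
    · linarith [((hC k r hr).2 i).2]
  · obtain ⟨C, hC⟩ := hM d
    exact ⟨C, fun r hr => (hC k r ⟨hr.1, hr.2.trans_le (min_le_left _ _)⟩).1⟩
  · obtain ⟨_, hC₁⟩ := hM d
    obtain ⟨C, hC⟩ := hM (d * (2 * (i : ℕ) + 1))
    have hev : ∀ᶠ r in nhdsWithin (0 : ℝ) (Set.Ioo 0 1), r ∈ Set.Ioo (0 : ℝ) r₀ := by
      filter_upwards [self_mem_nhdsWithin, nhdsWithin_le_nhds (Iio_mem_nhds hr₀.1)] with r h1 h2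
      exact ⟨h1.1, h2⟩
    have hpos : ∀ r ∈ Set.Ioo (0 : ℝ) r₀, ∀ᵐ z ∂(ν i r), 0 ≤ r ^ ((k : ℕ) + 1) * z k := by
      intro r hr
      filter_upwards [hBAR.ae_face ⟨hr.1, hr.2.trans_le hr₀.2⟩ i] with z hz
      exact mul_nonneg (pow_nonneg hr.1.le _) (hz.1 k)
    have hlim : Tendsto (fun r : ℝ => √r + r * C) (nhdsWithin 0 (Set.Ioo 0 1)) (nhds 0) := by
      have : Tendsto (fun r : ℝ => √r + r * C) (nhds 0) (nhds (√0 + 0 * C)) :=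
        (Real.continuous_sqrt.add (continuous_id.mul continuous_const)).tendsto 0
      simpa using this.mono_left nhdsWithin_le_nhds
    refine tendsto_of_tendsto_of_tendsto_of_le_of_le' tendsto_const_nhds hlim ?_ ?_
    · filter_upwards [hev] with r hr
      refine mul_nonneg hr.1.le (integral_nonneg_of_ae ?_)
      filter_upwards [hpos r hr] with z hz
      exact pow_nonneg hz d
    · filter_upwards [hev] with r hr
      have := ((hBAR r ⟨hr.1, hr.2.trans_le hr₀.2⟩).2.2.1 i).1
      obtain ⟨hI, hIC⟩ := (hC k r hr).2 i
      have hI₁ := ((hC₁ k r hr).2 i).1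
      calc r * ∫ z, (r ^ ((k : ℕ) + 1) * z k) ^ d ∂(ν i r)
          = ∫ z, r * (r ^ ((k : ℕ) + 1) * z k) ^ d ∂(ν i r) := (integral_const_mul _ _).symm
        _ ≤ ∫ z, (√r + r * (r ^ (i : ℕ) *
              (r ^ ((k : ℕ) + 1) * z k) ^ (d * (2 * (i : ℕ) + 1)))) ∂(ν i r) := by
            refine integral_mono_ae (hI₁.const_mul r)
              ((integrable_const _).add ((hI.const_mul _).const_mul _)) ?_
            filter_upwards [hpos r hr] with z hz
            rw [pow_mul]
            exact mul_le_sqrt_add_pow hr.1.le (pow_nonneg hz d) i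
        _ = √r + r * (r ^ (i : ℕ) *
              ∫ z, (r ^ ((k : ℕ) + 1) * z k) ^ (d * (2 * (i : ℕ) + 1)) ∂(ν i r)) := by
            rw [integral_add (integrable_const _) ((hI.const_mul _).const_mul _),
              integral_const_mul, integral_const_mul]
            simp
        _ ≤ √r + r * C := by
            have := hr.1.le
            gcongr

end SRBMPaper
end
end

section
/- Let d = 2, let Γ be a 2×2 symmetric positive definite real matrix, and let R be a 2×2 P-matrix (R_{11} > 0, R_{22} > 0, R_{11}R_{22} − R_{12}R_{21} > 0). Suppose that for each r ∈ (0,1) the Borel probability measures π^r, ν_1^r, ν_2^r on ℝ₊² satisfy the basic adjoint relationship. Set r₀ = min{1, R_{11}/(2|R_{12}|)} (with r₀ = 1 if R_{12} = 0). Then for every k ∈ {1,2} and every integer n ≥ 0 there are finite constants C_{k,n}, C_{1,k,n}, C_{2,k,n} with ∫(r^k z_k)^n dπ^r(z) < C_{k,n} and r^{i−1} ∫(r^k z_k)^n dν_i^r(z) < C_{i,k,n} for i = 1, 2 and all r ∈ (0, r₀). In particular, the uniform moment bound condition holds. -/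
open MeasureTheory Filter

noncomputable section

namespace SRBMPaper

/-- A bounded, smooth approximation of `x ↦ exp (θ x) / θ`. -/
def truncExp (θ ε x : ℝ) : ℝ := Real.exp (θ * x) / (θ * (1 + ε * Real.exp (θ * x)))

/-- The derivative of `truncExp`, which increases to `exp (θ x)` as `ε` decreases to `0`. -/
def truncExp' (θ ε x : ℝ) : ℝ := Real.exp (θ * x) / (1 + ε * Real.exp (θ * x)) ^ 2

/-- The second derivative of `truncExp`. -/
def truncExp'' (θ ε x : ℝ) : ℝ :=
  θ * Real.exp (θ * x) * (1 - ε * Real.exp (θ * x)) / (1 + ε * Real.exp (θ * x)) ^ 3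

/-- An affine function of `z` corrected by a term that is exponentially localized
near the face `z 1 = 0`. -/
def bentLinear (α β p q : ℝ) (z : Fin 2 → ℝ) : ℝ :=
  α * z 0 + β * z 1 + p * Real.exp (-(q * z 1))

/-- The partial derivative of `bentLinear` in the second coordinate. -/
def bentSlope (β p q : ℝ) (z : Fin 2 → ℝ) : ℝ := β - p * q * Real.exp (-(q * z 1))

section TruncExp

variable {θ ε : ℝ}

lemma one_add_mul_exp_pos (hε : 0 < ε) (x : ℝ) : 0 < 1 + ε * Real.exp (θ * x) := by
  positivity

lemma hasDerivAt_exp_const_mul (θ x : ℝ) :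
    HasDerivAt (fun x => Real.exp (θ * x)) (θ * Real.exp (θ * x)) x := by
  have h := ((hasDerivAt_id x).const_mul θ).exp
  simp only [id, mul_one] at h
  rwa [mul_comm] at h

lemma hasDerivAt_truncExp (hθ : 0 < θ) (hε : 0 < ε) (x : ℝ) :
    HasDerivAt (truncExp θ ε) (truncExp' θ ε x) x := by
  have hp := one_add_mul_exp_pos (θ := θ) hε x
  have hE := hasDerivAt_exp_const_mul θ x
  have h := hE.div (((hE.const_mul ε).const_add 1).const_mul θ) (by positivity)
  refine h.congr_deriv ?_
  unfold truncExp'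
  field_simp
  ring

lemma hasDerivAt_truncExp' (hε : 0 < ε) (x : ℝ) :
    HasDerivAt (truncExp' θ ε) (truncExp'' θ ε x) x := by
  have hp := one_add_mul_exp_pos (θ := θ) hε x
  have hE := hasDerivAt_exp_const_mul θ x
  have hsq : HasDerivAt (fun x => (1 + ε * Real.exp (θ * x)) ^ 2)
      (2 * (1 + ε * Real.exp (θ * x)) * (ε * (θ * Real.exp (θ * x)))) x :=
    (((hE.const_mul ε).const_add 1).pow 2).congr_deriv (by simp)
  refine (hE.div hsq (by positivity)).congr_deriv ?_
  unfold truncExp''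
  field_simp
  ring

lemma contDiff_truncExp (hθ : 0 < θ) (hε : 0 < ε) : ContDiff ℝ 2 (truncExp θ ε) := by
  unfold truncExp
  refine ContDiff.div (by fun_prop) (by fun_prop) fun x => ?_
  have hp := one_add_mul_exp_pos (θ := θ) hε x
  positivity

lemma continuous_truncExp' (hε : 0 < ε) : Continuous (truncExp' θ ε) :=
  continuous_iff_continuousAt.2 fun x => (hasDerivAt_truncExp' hε x).continuousAt

lemma continuous_truncExp'' (hε : 0 < ε) : Continuous (truncExp'' θ ε) := by
  unfold truncExp''
  refine Continuous.div (by fun_prop) (by fun_prop) fun x => ?_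
  have hp := one_add_mul_exp_pos (θ := θ) hε x
  positivity

lemma truncExp'_nonneg (hε : 0 < ε) (x : ℝ) : 0 ≤ truncExp' θ ε x := by
  unfold truncExp'
  positivity

lemma truncExp'_le_exp (hε : 0 < ε) (x : ℝ) : truncExp' θ ε x ≤ Real.exp (θ * x) := by
  unfold truncExp'
  refine div_le_self (Real.exp_pos _).le ?_
  exact one_le_pow₀ (by have := Real.exp_pos (θ * x); nlinarith [mul_pos hε this])

lemma truncExp'_le (hε : 0 < ε) (x : ℝ) : truncExp' θ ε x ≤ 1 / ε := by
  unfold truncExp'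
  rw [div_le_div_iff₀ (by positivity) hε]
  nlinarith [mul_pos hε (Real.exp_pos (θ * x)), sq_nonneg (ε * Real.exp (θ * x))]

lemma abs_truncExp_le (hθ : 0 < θ) (hε : 0 < ε) (x : ℝ) :
    |truncExp θ ε x| ≤ 1 / (θ * ε) := by
  unfold truncExp
  rw [abs_of_nonneg (by positivity), div_le_div_iff₀ (by positivity) (by positivity)]
  nlinarith

lemma abs_truncExp''_le (hθ : 0 < θ) (hε : 0 < ε) (x : ℝ) :
    |truncExp'' θ ε x| ≤ θ * truncExp' θ ε x := by
  have hp := one_add_mul_exp_pos (θ := θ) hε x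
  have hE := mul_pos hε (Real.exp_pos (θ * x))
  have h : truncExp'' θ ε x = θ * truncExp' θ ε x *
      ((1 - ε * Real.exp (θ * x)) / (1 + ε * Real.exp (θ * x))) := by
    unfold truncExp' truncExp''
    field_simp
  have hg := truncExp'_nonneg (θ := θ) hε x
  rw [h, abs_mul, abs_of_nonneg (by positivity)]
  refine mul_le_of_le_one_right (by positivity) ?_
  rw [abs_div, abs_of_pos hp, div_le_one hp, abs_le]
  constructor <;> linarith

end TruncExp

section TestFunction

variable {α β p q θ ε : ℝ}

lemma continuous_bentLinear : Continuous (bentLinear α β p q) := by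
  unfold bentLinear
  fun_prop

lemma continuous_bentSlope : Continuous (bentSlope β p q) := by
  unfold bentSlope
  fun_prop

lemma hasFDerivAt_coord (j : Fin 2) (z : Fin 2 → ℝ) :
    HasFDerivAt (fun z : Fin 2 → ℝ => z j)
      (ContinuousLinearMap.proj j : (Fin 2 → ℝ) →L[ℝ] ℝ) z :=
  (ContinuousLinearMap.proj (R := ℝ) (φ := fun _ : Fin 2 => ℝ) j).hasFDerivAt

lemma hasFDerivAt_exp_coord (q : ℝ) (z : Fin 2 → ℝ) :
    HasFDerivAt (fun z : Fin 2 → ℝ => Real.exp (-(q * z 1)))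
      ((-(q * Real.exp (-(q * z 1)))) •
        (ContinuousLinearMap.proj 1 : (Fin 2 → ℝ) →L[ℝ] ℝ)) z := by
  have h := (((hasFDerivAt_coord 1 z).const_mul q).neg).exp
  refine h.congr_fderiv ?_
  ext v
  simp
  ring

lemma hasFDerivAt_bentLinear (z : Fin 2 → ℝ) :
    HasFDerivAt (bentLinear α β p q)
      (α • (ContinuousLinearMap.proj 0 : (Fin 2 → ℝ) →L[ℝ] ℝ) +
        bentSlope β p q z • (ContinuousLinearMap.proj 1 : (Fin 2 → ℝ) →L[ℝ] ℝ)) z := by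
  have h := (((hasFDerivAt_coord 0 z).const_mul α).add
    ((hasFDerivAt_coord 1 z).const_mul β)).add ((hasFDerivAt_exp_coord q z).const_mul p)
  refine h.congr_fderiv ?_
  ext v
  simp [bentSlope]
  ring

lemma hasFDerivAt_bentSlope (z : Fin 2 → ℝ) :
    HasFDerivAt (bentSlope β p q)
      ((p * q ^ 2 * Real.exp (-(q * z 1))) •
        (ContinuousLinearMap.proj 1 : (Fin 2 → ℝ) →L[ℝ] ℝ)) z := by
  have h := ((hasFDerivAt_exp_coord q z).const_mul (p * q)).const_sub β
  refine h.congr_fderiv ?_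
  ext v
  simp
  ring

lemma pd1_truncExp_zero (hθ : 0 < θ) (hε : 0 < ε) (z : Fin 2 → ℝ) :
    pd1 (fun z => truncExp θ ε (bentLinear α β p q z)) 0 z =
      truncExp' θ ε (bentLinear α β p q z) * α := by
  have h := (hasDerivAt_truncExp hθ hε (bentLinear α β p q z)).comp_hasFDerivAt z
    (hasFDerivAt_bentLinear z)
  rw [pd1, HasFDerivAt.fderiv (by exact h)]
  simp

lemma pd1_truncExp_one (hθ : 0 < θ) (hε : 0 < ε) (z : Fin 2 → ℝ) :
    pd1 (fun z => truncExp θ ε (bentLinear α β p q z)) 1 z =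
      truncExp' θ ε (bentLinear α β p q z) * bentSlope β p q z := by
  have h := (hasDerivAt_truncExp hθ hε (bentLinear α β p q z)).comp_hasFDerivAt z
    (hasFDerivAt_bentLinear z)
  rw [pd1, HasFDerivAt.fderiv (by exact h)]
  simp

lemma hasFDerivAt_truncExp'_bentLinear (hε : 0 < ε) (z : Fin 2 → ℝ) :
    HasFDerivAt (fun z => truncExp' θ ε (bentLinear α β p q z))
      (truncExp'' θ ε (bentLinear α β p q z) •
      (α • (ContinuousLinearMap.proj 0 : (Fin 2 → ℝ) →L[ℝ] ℝ) +
        bentSlope β p q z • (ContinuousLinearMap.proj 1 : (Fin 2 → ℝ) →L[ℝ] ℝ))) z :=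
  (hasDerivAt_truncExp' hε (bentLinear α β p q z)).comp_hasFDerivAt z
    (hasFDerivAt_bentLinear z)

lemma pd2_truncExp_zero (hθ : 0 < θ) (hε : 0 < ε) (i : Fin 2) (z : Fin 2 → ℝ) :
    pd2 (fun z => truncExp θ ε (bentLinear α β p q z)) i 0 z =
      truncExp'' θ ε (bentLinear α β p q z) * α * ![α, bentSlope β p q z] i := by
  have h := (hasFDerivAt_truncExp'_bentLinear (α := α) (β := β) (p := p) (q := q) (θ := θ)
    hε z).mul_const α
  simp only [pd2, pd1_truncExp_zero hθ hε]
  rw [h.fderiv]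
  fin_cases i <;> simp <;> ring

lemma pd2_truncExp_one (hθ : 0 < θ) (hε : 0 < ε) (i : Fin 2) (z : Fin 2 → ℝ) :
    pd2 (fun z => truncExp θ ε (bentLinear α β p q z)) i 1 z =
      truncExp'' θ ε (bentLinear α β p q z) * bentSlope β p q z *
          ![α, bentSlope β p q z] i +
        truncExp' θ ε (bentLinear α β p q z) *
          ![0, p * q ^ 2 * Real.exp (-(q * z 1))] i := by
  have h := (hasFDerivAt_truncExp'_bentLinear (α := α) (β := β) (p := p) (q := q) (θ := θ)
    hε z).mul (hasFDerivAt_bentSlope (β := β) (p := p) (q := q) z)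
  simp only [pd2, pd1_truncExp_one hθ hε]
  rw [HasFDerivAt.fderiv (by exact h)]
  fin_cases i <;> simp <;> ring

lemma exp_neg_mem_Icc (hq : 0 ≤ q) {z : Fin 2 → ℝ} (hz : z ∈ posOrthant 2) :
    Real.exp (-(q * z 1)) ∈ Set.Icc (0 : ℝ) 1 :=
  ⟨(Real.exp_pos _).le, Real.exp_le_one_iff.2 (neg_nonpos.2 (mul_nonneg hq (hz 1)))⟩

lemma abs_bentSlope_le (hq : 0 ≤ q) {z : Fin 2 → ℝ} (hz : z ∈ posOrthant 2) :
    |bentSlope β p q z| ≤ |β| + |p * q| := by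
  obtain ⟨h0, h1⟩ := exp_neg_mem_Icc hq hz
  unfold bentSlope
  refine (abs_sub _ _).trans ?_
  rw [abs_mul (p * q), abs_of_nonneg h0]
  gcongr
  exact mul_le_of_le_one_right (abs_nonneg _) h1

lemma isC2Bounded_truncExp_bentLinear (hθ : 0 < θ) (hε : 0 < ε) (hq : 0 ≤ q) :
    IsC2Bounded (fun z => truncExp θ ε (bentLinear α β p q z)) := by
  refine ⟨(contDiff_truncExp hθ hε).comp (by unfold bentLinear; fun_prop), ?_⟩
  set M := |α| + (|β| + |p * q|) with hM
  refine ⟨1 / (θ * ε) + 1 / ε * M + (θ * (1 / ε) * M * M + 1 / ε * (|p| * q ^ 2)),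
    fun z hz => ?_⟩
  have hD : |bentSlope β p q z| ≤ M :=
    (abs_bentSlope_le hq hz).trans (le_add_of_nonneg_left (abs_nonneg _))
  have hα : |α| ≤ M := le_add_of_nonneg_right (by positivity)
  have hM0 : 0 ≤ M := by positivity
  have hg : |truncExp' θ ε (bentLinear α β p q z)| ≤ 1 / ε := by
    rw [abs_of_nonneg (truncExp'_nonneg hε _)]
    exact truncExp'_le hε _
  have hh : |truncExp'' θ ε (bentLinear α β p q z)| ≤ θ * (1 / ε) :=
    (abs_truncExp''_le hθ hε _).trans
      (mul_le_mul_of_nonneg_left (truncExp'_le hε _) hθ.le)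
  have n1 : 0 ≤ 1 / (θ * ε) := by positivity
  have n2 : 0 ≤ 1 / ε * M := by positivity
  have n3 : 0 ≤ θ * (1 / ε) * M * M := by positivity
  have n4 : 0 ≤ 1 / ε * (|p| * q ^ 2) := by positivity
  have hvec : ∀ i, |![α, bentSlope β p q z] i| ≤ M := by
    intro i
    fin_cases i
    · exact hα
    · exact hD
  have hvec' : ∀ i, |![0, p * q ^ 2 * Real.exp (-(q * z 1))] i| ≤ |p| * q ^ 2 := by
    obtain ⟨h0, h1⟩ := exp_neg_mem_Icc hq hz
    intro i
    fin_cases i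
    · simp only [Fin.zero_eta, Matrix.cons_val_zero, abs_zero]
      positivity
    · simp only [Fin.mk_one, Matrix.cons_val_one, Matrix.cons_val_fin_one]
      rw [abs_mul, abs_mul, abs_of_nonneg h0, abs_of_nonneg (sq_nonneg q)]
      exact mul_le_of_le_one_right (by positivity) h1
  refine ⟨(abs_truncExp_le hθ hε _).trans (by linarith), fun j => ?_, fun i j => ?_⟩
  · fin_cases j
    · simp only [Fin.zero_eta]
      rw [pd1_truncExp_zero hθ hε, abs_mul]
      have : |truncExp' θ ε (bentLinear α β p q z)| * |α| ≤ 1 / ε * M := by gcongr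
      linarith
    · simp only [Fin.mk_one]
      rw [pd1_truncExp_one hθ hε, abs_mul]
      have : |truncExp' θ ε (bentLinear α β p q z)| * |bentSlope β p q z| ≤ 1 / ε * M := by
        gcongr
      linarith
  · fin_cases j
    · simp only [Fin.zero_eta]
      rw [pd2_truncExp_zero hθ hε, abs_mul, abs_mul]
      have := mul_le_mul (mul_le_mul hh hα (abs_nonneg _) (by positivity)) (hvec i)
        (abs_nonneg _) (by positivity)
      linarith
    · simp only [Fin.mk_one]
      rw [pd2_truncExp_one hθ hε]
      refine (abs_add_le _ _).trans ?_
      rw [abs_mul, abs_mul, abs_mul]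
      have h1 := mul_le_mul (mul_le_mul hh hD (abs_nonneg _) (by positivity)) (hvec i)
        (abs_nonneg _) (by positivity)
      have h2 := mul_le_mul hg (hvec' i) (abs_nonneg _) (by positivity)
      linarith

end TestFunction

section BoundedContinuous

/-- `F` is continuous, and bounded on the orthant. -/
def ContBddOn (F : (Fin 2 → ℝ) → ℝ) : Prop :=
  Continuous F ∧ ∃ C, ∀ z ∈ posOrthant 2, |F z| ≤ C

variable {F G : (Fin 2 → ℝ) → ℝ}

lemma contBddOn_const (c : ℝ) : ContBddOn fun _ => c :=
  ⟨continuous_const, |c|, fun _ _ => le_rfl⟩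

lemma ContBddOn.add (hF : ContBddOn F) (hG : ContBddOn G) :
    ContBddOn fun z => F z + G z := by
  obtain ⟨hF, C, hC⟩ := hF
  obtain ⟨hG, D, hD⟩ := hG
  exact ⟨hF.add hG, C + D, fun z hz =>
    (abs_add_le _ _).trans (add_le_add (hC z hz) (hD z hz))⟩

lemma ContBddOn.mul (hF : ContBddOn F) (hG : ContBddOn G) :
    ContBddOn fun z => F z * G z := by
  obtain ⟨hF, C, hC⟩ := hF
  obtain ⟨hG, D, hD⟩ := hG
  refine ⟨hF.mul hG, C * D, fun z hz => ?_⟩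
  rw [abs_mul]
  exact mul_le_mul (hC z hz) (hD z hz) (abs_nonneg _) ((abs_nonneg _).trans (hC z hz))

lemma ContBddOn.integrable (hF : ContBddOn F) {μ : Measure (Fin 2 → ℝ)} [IsFiniteMeasure μ]
    (hμ : ∀ᵐ z ∂μ, z ∈ posOrthant 2) : Integrable F μ := by
  obtain ⟨hF, C, hC⟩ := hF
  exact Integrable.of_bound hF.aestronglyMeasurable C (hμ.mono hC)

end BoundedContinuous

lemma isClosed_posOrthant (d : ℕ) : IsClosed (posOrthant d) := by
  simp only [posOrthant, Set.ofPred_forall]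
  exact isClosed_iInter fun i => isClosed_le continuous_const (continuous_apply i)

lemma isClosed_face {d : ℕ} (i : Fin d) : IsClosed {z | z ∈ posOrthant d ∧ z i = 0} :=
  (isClosed_posOrthant d).inter (isClosed_eq (continuous_apply i) continuous_const)

lemma ae_mem_of_isClosed {X : Type*} [TopologicalSpace X] [MeasurableSpace X]
    [OpensMeasurableSpace X] {μ : Measure X} [IsProbabilityMeasure μ] {s : Set X}
    (hs : IsClosed s) (h : μ s = 1) : ∀ᵐ x ∂μ, x ∈ s :=
  mem_ae_iff.2 ((prob_compl_eq_zero_iff hs.measurableSet).2 h)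

/-- The drift inequality obtained by testing the basic adjoint relationship against
`truncExp θ ε ∘ bentLinear α β p q`. -/
lemma SatisfiesBAR.drift_inequality {Γ R : Matrix (Fin 2) (Fin 2) ℝ} {r : ℝ}
    {π : Measure (Fin 2 → ℝ)} {ν : Fin 2 → Measure (Fin 2 → ℝ)}
    (hBAR : SatisfiesBAR Γ R r π ν) (hr : 0 < r)
    [IsProbabilityMeasure π] [∀ i, IsProbabilityMeasure (ν i)]
    (hπ : ∀ᵐ z ∂π, z ∈ posOrthant 2)
    (hν : ∀ i, ∀ᵐ z ∂(ν i), z ∈ posOrthant 2 ∧ z i = 0)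
    {α β p q θ ε κ b₀ b₁ : ℝ} (hθ : 0 < θ) (hε : 0 < ε) (hq : 0 ≤ q)
    (hA : ∀ e ∈ Set.Icc (0 : ℝ) 1,
      1 / 2 * (θ * |Γ 0 0 * α ^ 2 + (Γ 0 1 + Γ 1 0) * α * (β - p * q * e)
          + Γ 1 1 * (β - p * q * e) ^ 2| + Γ 1 1 * (p * q ^ 2 * e))
        - r * (R 0 0 * α + R 1 0 * (β - p * q * e))
        - r ^ 2 * (R 0 1 * α + R 1 1 * (β - p * q * e)) ≤ -κ)
    (hB₀ : ∀ e ∈ Set.Icc (0 : ℝ) 1, R 0 0 * α + R 1 0 * (β - p * q * e) ≤ b₀)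
    (hB₁ : R 0 1 * α + R 1 1 * (β - p * q) ≤ b₁) :
    κ * ∫ z, truncExp' θ ε (bentLinear α β p q z) ∂π ≤
      r * (b₀ * ∫ z, truncExp' θ ε (bentLinear α β p q z) ∂(ν 0)) +
      r ^ 2 * (b₁ * ∫ z, truncExp' θ ε (bentLinear α β p q z) ∂(ν 1)) := by
  have hbar := hBAR _ (isC2Bounded_truncExp_bentLinear (α := α) (β := β) (p := p) hθ hε hq)
  simp only [Fin.sum_univ_two, pd1_truncExp_zero hθ hε, pd1_truncExp_one hθ hε,
    pd2_truncExp_zero hθ hε, pd2_truncExp_one hθ hε, Matrix.cons_val_zero,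
    Matrix.cons_val_one, Matrix.cons_val_fin_one, Fin.val_zero, Fin.val_one, zero_add,
    pow_one, mul_zero, add_zero, one_add_one_eq_two] at hbar
  have hg : ContBddOn fun z => truncExp' θ ε (bentLinear α β p q z) :=
    ⟨(continuous_truncExp' hε).comp continuous_bentLinear, 1 / ε, fun z _ => by
      rw [abs_of_nonneg (truncExp'_nonneg hε _)]
      exact truncExp'_le hε _⟩
  have hh : ContBddOn fun z => truncExp'' θ ε (bentLinear α β p q z) :=
    ⟨(continuous_truncExp'' hε).comp continuous_bentLinear, θ * (1 / ε), fun z _ =>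
      (abs_truncExp''_le hθ hε _).trans (mul_le_mul_of_nonneg_left (truncExp'_le hε _) hθ.le)⟩
  have hD : ContBddOn (bentSlope β p q) :=
    ⟨continuous_bentSlope, _, fun z hz => abs_bentSlope_le hq hz⟩
  have he : ContBddOn fun z => Real.exp (-(q * z 1)) :=
    ⟨by fun_prop, 1, fun z hz => by
      rw [abs_of_nonneg (exp_neg_mem_Icc hq hz).1]
      exact (exp_neg_mem_Icc hq hz).2⟩
  have c := contBddOn_const
  have hν' : ∀ i, ∀ᵐ z ∂(ν i), z ∈ posOrthant 2 := fun i => (hν i).mono fun z hz => hz.1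
  have hdrift : ∀ j, ContBddOn fun z => R 0 j * (truncExp' θ ε (bentLinear α β p q z) * α) +
      R 1 j * (truncExp' θ ε (bentLinear α β p q z) * bentSlope β p q z) := fun j =>
    ((c (R 0 j)).mul (hg.mul (c α))).add ((c (R 1 j)).mul (hg.mul hD))
  have hdiff : ContBddOn fun z =>
      Γ 0 0 * (truncExp'' θ ε (bentLinear α β p q z) * α * α) +
        Γ 0 1 * (truncExp'' θ ε (bentLinear α β p q z) * bentSlope β p q z * α) +
      (Γ 1 0 * (truncExp'' θ ε (bentLinear α β p q z) * α * bentSlope β p q z) +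
        Γ 1 1 * (truncExp'' θ ε (bentLinear α β p q z) * bentSlope β p q z * bentSlope β p q z +
          truncExp' θ ε (bentLinear α β p q z) * (p * q ^ 2 * Real.exp (-(q * z 1))))) :=
    (((c _).mul ((hh.mul (c _)).mul (c _))).add ((c _).mul ((hh.mul hD).mul (c _)))).add
      (((c _).mul ((hh.mul (c _)).mul hD)).add ((c _).mul (((hh.mul hD).mul hD).add
        (hg.mul ((c _).mul he)))))
  have hquad := ((hdiff.integrable hπ).const_mul (1 / 2)).sub
    (((hdrift 0).integrable hπ).const_mul r)
  have h0 := integral_mono_ae (hquad.sub (((hdrift 1).integrable hπ).const_mul (r ^ 2)))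
    ((hg.integrable hπ).const_mul (-κ)) (by
      filter_upwards [hπ] with z hz
      have h := mul_le_mul_of_nonneg_left (hA _ (exp_neg_mem_Icc hq hz))
        (truncExp'_nonneg (θ := θ) hε (bentLinear α β p q z))
      have hQ : truncExp'' θ ε (bentLinear α β p q z) *
          (Γ 0 0 * α ^ 2 + (Γ 0 1 + Γ 1 0) * α * bentSlope β p q z
            + Γ 1 1 * bentSlope β p q z ^ 2) ≤
          θ * truncExp' θ ε (bentLinear α β p q z) *
          |Γ 0 0 * α ^ 2 + (Γ 0 1 + Γ 1 0) * α * bentSlope β p q z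
            + Γ 1 1 * bentSlope β p q z ^ 2| := by
        refine (le_abs_self _).trans ?_
        rw [abs_mul]
        exact mul_le_mul_of_nonneg_right (abs_truncExp''_le hθ hε _) (abs_nonneg _)
      simp only [Pi.sub_apply]
      simp only [← bentSlope.eq_def β p q z] at h
      linarith)
  have h1 := integral_mono_ae ((hdrift 0).integrable (hν' 0))
    ((hg.integrable (hν' 0)).const_mul b₀) (by
      filter_upwards [hν' 0] with z hz
      have h := mul_le_mul_of_nonneg_left (hB₀ _ (exp_neg_mem_Icc hq hz))
        (truncExp'_nonneg (θ := θ) hε (bentLinear α β p q z))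
      simp only [← bentSlope.eq_def β p q z] at h
      linarith)
  have h2 := integral_mono_ae ((hdrift 1).integrable (hν' 1))
    ((hg.integrable (hν' 1)).const_mul b₁) (by
      filter_upwards [hν 1] with z hz
      have h := mul_le_mul_of_nonneg_left hB₁
        (truncExp'_nonneg (θ := θ) hε (bentLinear α β p q z))
      have hz1 : bentSlope β p q z = β - p * q := by simp [bentSlope, hz.2]
      simp only [hz1]
      linarith)
  rw [integral_sub' hquad (((hdrift 1).integrable hπ).const_mul (r ^ 2)),
    integral_sub' ((hdiff.integrable hπ).const_mul (1 / 2))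
      (((hdrift 0).integrable hπ).const_mul r)] at h0
  simp only [integral_const_mul] at h0 h1 h2
  have h1' := mul_le_mul_of_nonneg_left h1 hr.le
  have h2' := mul_le_mul_of_nonneg_left h2 (sq_nonneg r)
  linarith

section ExpMoment

/-- The exponential moment of `φ` under `μ` is finite and at most `C`. -/
def ExpMomentLE {X : Type*} [MeasurableSpace X] (μ : Measure X) (φ : X → ℝ) (C : ℝ) : Prop :=
  Integrable (fun x => Real.exp (φ x)) μ ∧ ∫ x, Real.exp (φ x) ∂μ ≤ C

variable {X : Type*} [MeasurableSpace X] {μ : Measure X}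

lemma expMomentLE_of_le_const [IsProbabilityMeasure μ] {φ : X → ℝ} (hφ : AEMeasurable φ μ)
    {C : ℝ} (h : ∀ᵐ x ∂μ, φ x ≤ C) : ExpMomentLE μ φ (Real.exp C) := by
  have hi : Integrable (fun x => Real.exp (φ x)) μ :=
    Integrable.of_bound (Real.measurable_exp.comp_aemeasurable hφ).aestronglyMeasurable
      (Real.exp C) (h.mono fun x hx => by
        rw [Real.norm_eq_abs, Real.abs_exp]
        exact Real.exp_le_exp.2 hx)
  refine ⟨hi, ?_⟩
  have := integral_mono_ae hi (integrable_const (Real.exp C))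
    (h.mono fun x hx => Real.exp_le_exp.2 hx)
  simpa using this

lemma ExpMomentLE.of_exp_le [IsProbabilityMeasure μ] {φ ψ : X → ℝ} {C : ℝ}
    (hψ : ExpMomentLE μ ψ C) (hφ : AEMeasurable φ μ) {a b : ℝ} (ha : 0 ≤ a)
    (h : ∀ᵐ x ∂μ, Real.exp (φ x) ≤ a * Real.exp (ψ x) + b) :
    ExpMomentLE μ φ (a * C + b) := by
  have hi := (hψ.1.const_mul a).add (integrable_const b)
  have hi' : Integrable (fun x => Real.exp (φ x)) μ :=
    hi.mono' (Real.measurable_exp.comp_aemeasurable hφ).aestronglyMeasurable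
      (h.mono fun x hx => by rwa [Real.norm_eq_abs, Real.abs_exp])
  refine ⟨hi', (integral_mono_ae hi' hi h).trans ?_⟩
  rw [integral_add' (hψ.1.const_mul a) (integrable_const b), integral_const_mul]
  simp only [integral_const, probReal_univ, one_smul]
  have := mul_le_mul_of_nonneg_left hψ.2 ha
  linarith

lemma ExpMomentLE.of_le_add_const [IsProbabilityMeasure μ] {φ ψ : X → ℝ} {C K : ℝ}
    (hψ : ExpMomentLE μ ψ C) (hφ : AEMeasurable φ μ) (h : ∀ᵐ x ∂μ, φ x ≤ ψ x + K) :
    ExpMomentLE μ φ (Real.exp K * C) := by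
  have := hψ.of_exp_le hφ (a := Real.exp K) (b := 0) (Real.exp_pos _).le
    (h.mono fun x hx => by
      rw [add_zero, ← Real.exp_add, add_comm]
      exact Real.exp_le_exp.2 hx)
  simpa using this

lemma integral_truncExp'_nonneg {θ ε : ℝ} (hε : 0 < ε) (φ : X → ℝ) :
    0 ≤ ∫ x, truncExp' θ ε (φ x) ∂μ :=
  integral_nonneg fun _ => truncExp'_nonneg hε _

lemma ExpMomentLE.integral_truncExp'_le {θ ε C : ℝ} (hε : 0 < ε) {φ : X → ℝ}
    (h : ExpMomentLE μ (fun x => θ * φ x) C) :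
    ∫ x, truncExp' θ ε (φ x) ∂μ ≤ C :=
  (integral_mono_of_nonneg (ae_of_all _ fun _ => truncExp'_nonneg hε _) h.1
    (ae_of_all _ fun _ => truncExp'_le_exp hε _)).trans h.2

lemma expMomentLE_of_integral_truncExp'_le [IsProbabilityMeasure μ] {θ C : ℝ} {φ : X → ℝ}
    (hφ : Measurable φ) (h : ∀ ε > 0, ∫ x, truncExp' θ ε (φ x) ∂μ ≤ C) :
    ExpMomentLE μ (fun x => θ * φ x) C := by
  have hεn : ∀ n : ℕ, (0 : ℝ) < 1 / ((n : ℝ) + 1) := fun n => by positivity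
  have hmeas : ∀ n : ℕ, Measurable fun x => truncExp' θ (1 / ((n : ℝ) + 1)) (φ x) := fun n =>
    (continuous_truncExp' (hεn n)).measurable.comp hφ
  have hC : 0 ≤ C := (integral_nonneg fun _ => truncExp'_nonneg one_pos _).trans (h 1 one_pos)
  have hlim : ∀ x, Tendsto (fun n : ℕ => ENNReal.ofReal (truncExp' θ (1 / ((n : ℝ) + 1)) (φ x)))
      atTop (nhds (ENNReal.ofReal (Real.exp (θ * φ x)))) := fun x => by
    refine ENNReal.tendsto_ofReal ?_
    have h0 := tendsto_one_div_add_atTop_nhds_zero_nat (𝕜 := ℝ)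
    have h1 := (((h0.mul_const (Real.exp (θ * φ x))).const_add 1).pow 2)
    have h2 := (tendsto_const_nhds (x := Real.exp (θ * φ x))).div h1 (by simp)
    simpa [truncExp', Pi.div_def] using h2
  have hfatou : ∫⁻ x, ENNReal.ofReal (Real.exp (θ * φ x)) ∂μ ≤ ENNReal.ofReal C := by
    calc ∫⁻ x, ENNReal.ofReal (Real.exp (θ * φ x)) ∂μ
        = ∫⁻ x, liminf (fun n : ℕ =>
            ENNReal.ofReal (truncExp' θ (1 / ((n : ℝ) + 1)) (φ x))) atTop ∂μ :=
          lintegral_congr fun x => (hlim x).liminf_eq.symm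
      _ ≤ liminf (fun n : ℕ => ∫⁻ x,
            ENNReal.ofReal (truncExp' θ (1 / ((n : ℝ) + 1)) (φ x)) ∂μ) atTop :=
          lintegral_liminf_le fun n => (hmeas n).ennreal_ofReal
      _ ≤ ENNReal.ofReal C := by
          refine liminf_le_of_le (by isBoundedDefault) fun b hb => ?_
          obtain ⟨n, hn⟩ := hb.exists
          refine hn.trans ?_
          rw [← ofReal_integral_eq_lintegral_ofReal
            (Integrable.of_bound (hmeas n).aestronglyMeasurable (1 / (1 / ((n : ℝ) + 1)))
              (ae_of_all _ fun x => by
                rw [Real.norm_eq_abs, abs_of_nonneg (truncExp'_nonneg (hεn n) _)]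
                exact truncExp'_le (hεn n) _))
            (ae_of_all _ fun x => truncExp'_nonneg (hεn n) _)]
          exact ENNReal.ofReal_le_ofReal (h _ (hεn n))
  have hm : AEStronglyMeasurable (fun x => Real.exp (θ * φ x)) μ :=
    (Real.measurable_exp.comp (hφ.const_mul θ)).aestronglyMeasurable
  refine ⟨⟨hm, ?_⟩, ?_⟩
  · rw [hasFiniteIntegral_iff_ofReal (ae_of_all _ fun x => (Real.exp_pos _).le)]
    exact hfatou.trans_lt ENNReal.ofReal_lt_top
  · rw [integral_eq_lintegral_of_nonneg_ae (ae_of_all _ fun x => (Real.exp_pos _).le) hm]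
    exact ENNReal.toReal_le_of_le_ofReal hC hfatou

lemma ExpMomentLE.integral_pow_le {θ C : ℝ} (hθ : 0 < θ) {φ : X → ℝ}
    (hφ : ∀ᵐ x ∂μ, 0 ≤ φ x) (h : ExpMomentLE μ (fun x => θ * φ x) C) (n : ℕ) :
    ∫ x, φ x ^ n ∂μ ≤ n.factorial / θ ^ n * C := by
  calc ∫ x, φ x ^ n ∂μ ≤ ∫ x, n.factorial / θ ^ n * Real.exp (θ * φ x) ∂μ := by
        refine integral_mono_of_nonneg (hφ.mono fun x hx => pow_nonneg hx n)
          (h.1.const_mul _) (hφ.mono fun x hx => ?_)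
        have := Real.pow_div_factorial_le_exp (θ * φ x) (by positivity) n
        rw [div_le_iff₀ (by positivity), mul_pow] at this
        simp only
        rw [div_mul_eq_mul_div, le_div_iff₀ (by positivity)]
        linarith
    _ ≤ n.factorial / θ ^ n * C := by
        rw [integral_const_mul]
        exact mul_le_mul_of_nonneg_left h.2 (by positivity)

end ExpMoment

lemma IsPMatrix.entries_pos {R : Matrix (Fin 2) (Fin 2) ℝ} (hR : IsPMatrix R) :
    0 < R 0 0 ∧ 0 < R 1 1 ∧ 0 < R 0 0 * R 1 1 - R 0 1 * R 1 0 := by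
  have key : ∀ i, 0 < R i i := fun i => by
    have h := hR {i}
    have : Unique ({i} : Finset (Fin 2)) := 
      ⟨⟨⟨i, Finset.mem_singleton_self i⟩⟩, fun x => Subtype.ext (Finset.mem_singleton.1 x.2)⟩
    rw [Matrix.det_unique] at h
    have hd : ((default : ({i} : Finset (Fin 2))) : Fin 2) = i :=
      Finset.mem_singleton.1 (default : ({i} : Finset (Fin 2))).2
    simpa [hd] using h
  refine ⟨key 0, key 1, ?_⟩
  have h := hR Finset.univ
  let e : Fin 2 ≃ (Finset.univ : Finset (Fin 2)) :=
    ⟨fun i => ⟨i, Finset.mem_univ i⟩, fun i => i, fun _ => rfl, fun _ => rfl⟩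
  rw [← Matrix.det_submatrix_equiv_self e, Matrix.submatrix_submatrix, Matrix.det_fin_two] at h
  exact h

section Moments

variable {Γ R : Matrix (Fin 2) (Fin 2) ℝ} {r θ ε : ℝ}
  {π : Measure (Fin 2 → ℝ)} {ν : Fin 2 → Measure (Fin 2 → ℝ)}

lemma abs_quad_bentSlope_le (Γ : Matrix (Fin 2) (Fin 2) ℝ) (r c : ℝ) {e : ℝ}
    (he : e ∈ Set.Icc (0 : ℝ) 1) :
    |Γ 0 0 * r ^ 2 + (Γ 0 1 + Γ 1 0) * r * (0 - c * r * e) + Γ 1 1 * (0 - c * r * e) ^ 2| ≤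
      r ^ 2 * (|Γ 0 0| + |Γ 0 1 + Γ 1 0| * |c| + |Γ 1 1| * |c| ^ 2) := by
  obtain ⟨h0, h1⟩ := he
  have hce : |c * e| ≤ |c| := by
    rw [abs_mul, abs_of_nonneg h0]
    exact mul_le_of_le_one_right (abs_nonneg _) h1
  have h : Γ 0 0 * r ^ 2 + (Γ 0 1 + Γ 1 0) * r * (0 - c * r * e) + Γ 1 1 * (0 - c * r * e) ^ 2 =
      r ^ 2 * (Γ 0 0 - (Γ 0 1 + Γ 1 0) * (c * e) + Γ 1 1 * (c * e) ^ 2) := by ring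
  rw [h, abs_mul, abs_of_nonneg (sq_nonneg r)]
  gcongr
  refine (abs_add_le _ _).trans (add_le_add ((abs_sub _ _).trans ?_) ?_)
  · rw [abs_mul]
    gcongr
  · rw [abs_mul, abs_pow]
    gcongr

/-- The drift inequality for the test function whose slope in the second coordinate is
`-c r` at the face `z 1 = 0` and vanishes away from it, at scale `1 / (a r)`. -/
lemma SatisfiesBAR.bent_inequality (hBAR : SatisfiesBAR Γ R r π ν) (hr : 0 < r)
    [IsProbabilityMeasure π] [∀ i, IsProbabilityMeasure (ν i)]
    (hπ : ∀ᵐ z ∂π, z ∈ posOrthant 2)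
    (hν : ∀ i, ∀ᵐ z ∂(ν i), z ∈ posOrthant 2 ∧ z i = 0)
    {a c κ : ℝ} (ha : 0 < a) (hθ : 0 < θ) (hε : 0 < ε)
    (hκ : ∀ e ∈ Set.Icc (0 : ℝ) 1,
      κ ≤ R 0 0 - R 1 0 * (c * e) + r * (R 0 1 - R 1 1 * (c * e))) :
    (κ - θ * (|Γ 0 0| + |Γ 0 1 + Γ 1 0| * |c| + |Γ 1 1| * |c| ^ 2) / 2 - |Γ 1 1| * |c| * a / 2) *
        ∫ z, truncExp' θ ε (bentLinear r 0 (c / a) (a * r) z) ∂π ≤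
      (|R 0 0| + |R 1 0| * |c|) * Real.exp (θ * (|c| / a)) +
        r * ((R 0 1 - R 1 1 * c) *
          ∫ z, truncExp' θ ε (bentLinear r 0 (c / a) (a * r) z) ∂(ν 1)) := by
  have hpq : c / a * (a * r) = c * r := by field_simp
  have hpq2 : c / a * (a * r) ^ 2 = c * a * r ^ 2 := by field_simp
  have hce : ∀ e ∈ Set.Icc (0 : ℝ) 1, |c * e| ≤ |c| := fun e he => by
    rw [abs_mul, abs_of_nonneg he.1]
    exact mul_le_of_le_one_right (abs_nonneg _) he.2
  have hmain := hBAR.drift_inequality (α := r) (β := 0) (p := c / a) (q := a * r) (θ := θ)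
    (ε := ε)
    (κ := r ^ 2 * (κ - θ * (|Γ 0 0| + |Γ 0 1 + Γ 1 0| * |c| + |Γ 1 1| * |c| ^ 2) / 2
      - |Γ 1 1| * |c| * a / 2))
    (b₀ := r * (|R 0 0| + |R 1 0| * |c|)) (b₁ := r * (R 0 1 - R 1 1 * c))
    hr hπ hν hθ hε (by positivity)
    (fun e he => by
      rw [hpq, hpq2]
      have h1 := mul_le_mul_of_nonneg_left (abs_quad_bentSlope_le Γ r c he) hθ.le
      have h2 : Γ 1 1 * (c * e) ≤ |Γ 1 1| * |c| := by
        refine (le_abs_self _).trans ?_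
        rw [abs_mul]
        exact mul_le_mul_of_nonneg_left (hce e he) (abs_nonneg _)
      have h2' := mul_le_mul_of_nonneg_left h2 (by positivity : 0 ≤ a * r ^ 2)
      have h3 := mul_le_mul_of_nonneg_left (hκ e he) (sq_nonneg r)
      linarith)
    (fun e he => by
      rw [hpq]
      have h1 : -(R 1 0 * (c * e)) ≤ |R 1 0| * |c| := by
        refine (neg_le_abs _).trans ?_
        rw [abs_mul]
        exact mul_le_mul_of_nonneg_left (hce e he) (abs_nonneg _)
      have h1' := mul_le_mul_of_nonneg_left h1 hr.le
      have h2' := mul_le_mul_of_nonneg_left (le_abs_self (R 0 0)) hr.le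
      linarith)
    (by
      rw [hpq]
      linarith)
  have hν0 : ∫ z, truncExp' θ ε (bentLinear r 0 (c / a) (a * r) z) ∂(ν 0) ≤
      Real.exp (θ * (|c| / a)) := by
    refine ExpMomentLE.integral_truncExp'_le hε (expMomentLE_of_le_const
      (continuous_bentLinear.measurable.const_mul θ).aemeasurable ?_)
    filter_upwards [hν 0] with z hz
    have hE := exp_neg_mem_Icc (by positivity : 0 ≤ a * r) hz.1
    refine mul_le_mul_of_nonneg_left ?_ hθ.le
    rw [bentLinear, hz.2, mul_zero, zero_mul, zero_add, zero_add]
    refine (le_abs_self _).trans ?_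
    rw [abs_mul, abs_div, abs_of_pos ha, abs_of_nonneg hE.1]
    exact mul_le_of_le_one_right (by positivity) hE.2
  have hν0' := mul_le_mul_of_nonneg_left hν0
    (by positivity : 0 ≤ r ^ 2 * (|R 0 0| + |R 1 0| * |c|))
  refine le_of_mul_le_mul_left ?_ (by positivity : 0 < r ^ 2)
  linarith

lemma abs_bentLinear_sub_le {a c : ℝ} (ha : 0 < a) (hr : 0 < r) {z : Fin 2 → ℝ}
    (hz : z ∈ posOrthant 2) : |bentLinear r 0 (c / a) (a * r) z - r * z 0| ≤ |c| / a := by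
  have hE := exp_neg_mem_Icc (by positivity : 0 ≤ a * r) hz
  rw [bentLinear, zero_mul, add_zero, add_sub_cancel_left, abs_mul, abs_div, abs_of_pos ha,
    abs_of_nonneg hE.1]
  exact mul_le_of_le_one_right (by positivity) hE.2

/-- The drift inequality for the linear test function in the direction `(w, 1)`. -/
lemma SatisfiesBAR.linear_inequality (hBAR : SatisfiesBAR Γ R r π ν) (hr : 0 < r)
    [IsProbabilityMeasure π] [∀ i, IsProbabilityMeasure (ν i)]
    (hπ : ∀ᵐ z ∂π, z ∈ posOrthant 2)
    (hν : ∀ i, ∀ᵐ z ∂(ν i), z ∈ posOrthant 2 ∧ z i = 0)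
    (w : ℝ) (hθ : 0 < θ) (hε : 0 < ε) :
    (R 0 0 * w + R 1 0 + r * (R 0 1 * w + R 1 1 -
        θ * |Γ 0 0 * w ^ 2 + (Γ 0 1 + Γ 1 0) * w + Γ 1 1| / 2)) *
        ∫ z, truncExp' θ ε (r ^ 2 * (z 1 + w * z 0)) ∂π ≤
      (R 0 0 * w + R 1 0) * ∫ z, truncExp' θ ε (r ^ 2 * (z 1 + w * z 0)) ∂(ν 0) +
      r * ((R 0 1 * w + R 1 1) * ∫ z, truncExp' θ ε (r ^ 2 * (z 1 + w * z 0)) ∂(ν 1)) := by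
  have hW : ∀ z, bentLinear (r ^ 2 * w) (r ^ 2) 0 0 z = r ^ 2 * (z 1 + w * z 0) := fun z => by
    unfold bentLinear
    ring
  have hmain := hBAR.drift_inequality (α := r ^ 2 * w) (β := r ^ 2) (p := 0) (q := 0) (θ := θ)
    (ε := ε)
    (κ := r ^ 3 * (R 0 0 * w + R 1 0 + r * (R 0 1 * w + R 1 1 -
        θ * |Γ 0 0 * w ^ 2 + (Γ 0 1 + Γ 1 0) * w + Γ 1 1| / 2)))
    (b₀ := r ^ 2 * (R 0 0 * w + R 1 0)) (b₁ := r ^ 2 * (R 0 1 * w + R 1 1))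
    hr hπ hν hθ hε le_rfl
    (fun e he => by
      have hq : Γ 0 0 * (r ^ 2 * w) ^ 2 + (Γ 0 1 + Γ 1 0) * (r ^ 2 * w) * (r ^ 2 - 0 * 0 * e) +
          Γ 1 1 * (r ^ 2 - 0 * 0 * e) ^ 2 =
          r ^ 4 * (Γ 0 0 * w ^ 2 + (Γ 0 1 + Γ 1 0) * w + Γ 1 1) := by ring
      rw [hq, abs_mul, abs_of_nonneg (by positivity : 0 ≤ r ^ 4)]
      refine le_of_eq ?_
      ring)
    (fun e he => le_of_eq (by ring)) (le_of_eq (by ring))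
  simp only [hW] at hmain
  refine le_of_mul_le_mul_left ?_ (by positivity : 0 < r ^ 3)
  linarith

end Moments

lemma exp_mul_le_of_mem_Icc {r : ℝ} (hr : r ∈ Set.Icc (0 : ℝ) 1) (y : ℝ) :
    Real.exp (r * y) ≤ r * Real.exp y + 1 := by
  have h := convexOn_exp.2 (Set.mem_univ (0 : ℝ)) (Set.mem_univ y) (sub_nonneg.2 hr.2) hr.1
    (sub_add_cancel 1 r)
  simp only [smul_eq_mul, mul_zero, zero_add, Real.exp_zero, mul_one] at h
  linarith [hr.1]

section Family

variable {Γ R : Matrix (Fin 2) (Fin 2) ℝ}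
  {π : ℝ → Measure (Fin 2 → ℝ)} {ν : Fin 2 → ℝ → Measure (Fin 2 → ℝ)}

lemma BARFamily.ae_mem (h : BARFamily Γ R π ν) {r : ℝ} (hr : r ∈ Set.Ioo (0 : ℝ) 1) :
    IsProbabilityMeasure (π r) ∧ (∀ i, IsProbabilityMeasure (ν i r)) ∧
      (∀ᵐ z ∂(π r), z ∈ posOrthant 2) ∧ (∀ i, ∀ᵐ z ∂(ν i r), z ∈ posOrthant 2 ∧ z i = 0) ∧
      SatisfiesBAR Γ R r (π r) (fun i => ν i r) := by
  obtain ⟨h1, h2, h3, h4⟩ := h r hr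
  have h5 := fun i => (h3 i).1
  exact ⟨h1, h5, ae_mem_of_isClosed (isClosed_posOrthant 2) h2,
    fun i => ae_mem_of_isClosed (isClosed_face i) (h3 i).2, h4⟩

/-- Uniform exponential moments of `r z 0` in the interior. -/
lemma BARFamily.expMoment_first_interior (hR : IsPMatrix R) (h : BARFamily Γ R π ν) :
    ∃ θ > 0, ∃ C, ∀ r ∈ Set.Ioo (0 : ℝ) 1, r * |R 0 1| ≤ R 0 0 / 2 →
      ExpMomentLE (π r) (fun z => θ * (r * z 0)) C := by
  obtain ⟨h00, h11, hdet⟩ := hR.entries_pos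
  obtain ⟨c, hc⟩ : ∃ c, c = R 0 1 / R 1 1 := ⟨_, rfl⟩
  have hc' : R 1 1 * c = R 0 1 := by rw [hc]; field_simp
  have hδ : 0 < R 0 0 - R 1 0 * c := by
    have : R 1 1 * (R 0 0 - R 1 0 * c) = R 0 0 * R 1 1 - R 0 1 * R 1 0 := by rw [← hc']; ring
    exact pos_of_mul_pos_right (this ▸ hdet) h11.le
  obtain ⟨κ, hκ0, hκ1, hκ2⟩ : ∃ κ > 0, κ ≤ R 0 0 / 2 ∧ κ ≤ R 0 0 - R 1 0 * c :=
    ⟨min (R 0 0 / 2) (R 0 0 - R 1 0 * c), lt_min (by linarith) hδ, min_le_left _ _,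
      min_le_right _ _⟩
  obtain ⟨Q, hQ⟩ : ∃ Q, Q = |Γ 0 0| + |Γ 0 1 + Γ 1 0| * |c| + |Γ 1 1| * |c| ^ 2 := ⟨_, rfl⟩
  have hQ0 : 0 ≤ Q := hQ ▸ by positivity
  obtain ⟨θ, hθ, hθQ⟩ : ∃ θ > 0, θ * Q ≤ κ / 2 := by
    refine ⟨κ / (2 * (Q + 1)), by positivity, ?_⟩
    rw [div_mul_eq_mul_div, div_le_div_iff₀ (by positivity) two_pos]
    nlinarith
  obtain ⟨a, ha, haQ⟩ : ∃ a > 0, |Γ 1 1| * |c| * a ≤ κ / 2 := by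
    have hb : 0 ≤ |Γ 1 1| * |c| := by positivity
    refine ⟨κ / (2 * (|Γ 1 1| * |c| + 1)), by positivity, ?_⟩
    rw [← mul_div_assoc, div_le_div_iff₀ (by positivity) two_pos]
    nlinarith
  refine ⟨θ, hθ, Real.exp (θ * (|c| / a)) *
    (2 / κ * ((|R 0 0| + |R 1 0| * |c|) * Real.exp (θ * (|c| / a)))), fun r hr hr0 => ?_⟩
  obtain ⟨_, _, hπ, hν, hBAR⟩ := h.ae_mem hr
  have hW : ExpMomentLE (π r) (fun z => θ * bentLinear r 0 (c / a) (a * r) z)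
      (2 / κ * ((|R 0 0| + |R 1 0| * |c|) * Real.exp (θ * (|c| / a)))) := by
    refine expMomentLE_of_integral_truncExp'_le continuous_bentLinear.measurable fun ε hε => ?_
    have hmain := hBAR.bent_inequality (c := c) (κ := κ) hr.1 hπ hν ha hθ hε fun e he => by
      have h1 : -(r * R 0 1) ≤ R 0 0 / 2 :=
        (neg_le_abs _).trans (by rwa [abs_mul, abs_of_pos hr.1])
      have h2 : R 1 1 * (c * e) = R 0 1 * e := by rw [← hc']; ring
      rw [h2]
      have h3 := mul_le_mul_of_nonneg_left hκ2 he.1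
      have h4 := mul_le_mul_of_nonneg_left
        (by linarith : κ ≤ R 0 0 + r * R 0 1) (sub_nonneg.2 he.2)
      linarith
    rw [hc', sub_self, zero_mul, mul_zero, add_zero, ← hQ] at hmain
    have hI := integral_truncExp'_nonneg (μ := π r) (θ := θ) hε
        fun z => bentLinear r 0 (c / a) (a * r) z
    have hle := mul_le_mul_of_nonneg_right
      (by linarith : κ / 2 ≤ κ - θ * Q / 2 - |Γ 1 1| * |c| * a / 2) hI
    have hfin := mul_le_mul_of_nonneg_left (hle.trans hmain) (by positivity : 0 ≤ 2 / κ)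
    refine le_trans (le_of_eq ?_) hfin
    field_simp
  refine hW.of_le_add_const (Measurable.aemeasurable (by fun_prop)) ?_
  filter_upwards [hπ] with z hz
  have := (abs_le.1 (abs_bentLinear_sub_le (c := c) ha hr.1 hz)).1
  rw [← mul_add]
  exact mul_le_mul_of_nonneg_left (by linarith) hθ.le

/-- Exponential moments of `r z 0` on the face `z 1 = 0`, of order `1 / r`. -/
lemma BARFamily.expMoment_first_boundary (hR : IsPMatrix R) (h : BARFamily Γ R π ν) {θ C : ℝ}
    (hθ : 0 < θ) {S : Set ℝ} (hS : S ⊆ Set.Ioo 0 1)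
    (hC : ∀ r ∈ S, ExpMomentLE (π r) (fun z => θ * (r * z 0)) C) :
    ∃ C', ∀ r ∈ S, ExpMomentLE (ν 1 r) (fun z => θ * (r * z 0)) (C' / r) := by
  obtain ⟨h00, h11, hdet⟩ := hR.entries_pos
  obtain ⟨c, hc⟩ : ∃ c, c = (R 0 1 + 1) / R 1 1 := ⟨_, rfl⟩
  have hc' : R 0 1 - R 1 1 * c = -1 := by rw [hc]; field_simp; ring
  obtain ⟨Q, hQ⟩ : ∃ Q, Q = |Γ 0 0| + |Γ 0 1 + Γ 1 0| * |c| + |Γ 1 1| * |c| ^ 2 := ⟨_, rfl⟩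
  have hQ0 : 0 ≤ Q := hQ ▸ by positivity
  obtain ⟨κ, hκ⟩ : ∃ κ, κ = |R 0 0| + |R 1 0| * |c| + (|R 0 1| + |R 1 1| * |c|) := ⟨_, rfl⟩
  have hκ0 : 0 ≤ κ := hκ ▸ by positivity
  refine ⟨Real.exp (θ * |c|) * ((|R 0 0| + |R 1 0| * |c|) * Real.exp (θ * |c|) +
    (κ + θ * Q / 2 + |Γ 1 1| * |c| / 2) * (Real.exp (θ * |c|) * C)), fun r hrS => ?_⟩
  have hr := hS hrS
  obtain ⟨_, _, hπ, hν, hBAR⟩ := h.ae_mem hr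
  have hdist : ∀ z ∈ posOrthant 2, |bentLinear r 0 (c / 1) (1 * r) z - r * z 0| ≤ |c| :=
    fun z hz => by simpa using abs_bentLinear_sub_le (c := c) one_pos hr.1 hz
  have hWπ : ExpMomentLE (π r) (fun z => θ * bentLinear r 0 (c / 1) (1 * r) z)
      (Real.exp (θ * |c|) * C) := by
    refine (hC r hrS).of_le_add_const
      (continuous_bentLinear.measurable.const_mul θ).aemeasurable ?_
    filter_upwards [hπ] with z hz
    rw [← mul_add]
    exact mul_le_mul_of_nonneg_left (by linarith [(abs_le.1 (hdist z hz)).2]) hθ.le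
  have hW : ExpMomentLE (ν 1 r) (fun z => θ * bentLinear r 0 (c / 1) (1 * r) z)
      (((|R 0 0| + |R 1 0| * |c|) * Real.exp (θ * |c|) +
        (κ + θ * Q / 2 + |Γ 1 1| * |c| / 2) * (Real.exp (θ * |c|) * C)) / r) := by
    refine expMomentLE_of_integral_truncExp'_le continuous_bentLinear.measurable fun ε hε => ?_
    have hmain := hBAR.bent_inequality (c := c) (κ := -κ) hr.1 hπ hν one_pos hθ hε fun e he => by
      have hce : |c * e| ≤ |c| := by
        rw [abs_mul, abs_of_nonneg he.1]
        exact mul_le_of_le_one_right (abs_nonneg _) he.2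
      have h1 : |R 0 0 - R 1 0 * (c * e)| ≤ |R 0 0| + |R 1 0| * |c| :=
        (abs_sub _ _).trans (by rw [abs_mul]; gcongr)
      have h2 : |R 0 1 - R 1 1 * (c * e)| ≤ |R 0 1| + |R 1 1| * |c| :=
        (abs_sub _ _).trans (by rw [abs_mul]; gcongr)
      have h3 : |r * (R 0 1 - R 1 1 * (c * e))| ≤ |R 0 1| + |R 1 1| * |c| := by
        rw [abs_mul, abs_of_pos hr.1]
        exact (mul_le_of_le_one_left (abs_nonneg _) hr.2.le).trans h2
      linarith [(abs_le.1 h1).1, (abs_le.1 h3).1]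
    rw [hc', ← hQ, div_one |c|] at hmain
    have hπ' := mul_le_mul_of_nonneg_left (hWπ.integral_truncExp'_le hε)
      (by positivity : 0 ≤ κ + θ * Q / 2 + |Γ 1 1| * |c| / 2)
    rw [le_div_iff₀ hr.1]
    linarith
  refine (mul_div_assoc (Real.exp (θ * |c|)) _ r) ▸
    hW.of_le_add_const (Measurable.aemeasurable (by fun_prop)) ?_
  filter_upwards [hν 1] with z hz
  rw [← mul_add]
  exact mul_le_mul_of_nonneg_left (by linarith [(abs_le.1 (hdist z hz.1)).1]) hθ.le

lemma expMoment_face_one {μ : Measure (Fin 2 → ℝ)} [IsProbabilityMeasure μ]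
    (hμ : ∀ᵐ z ∂μ, z ∈ posOrthant 2 ∧ z 1 = 0) {r θ θ₀ w C : ℝ} (hr : r ∈ Set.Ioo (0 : ℝ) 1)
    (hw : θ * w ≤ θ₀) (hC : ExpMomentLE μ (fun z => θ₀ * (r * z 0)) (C / r)) :
    ExpMomentLE μ (fun z => θ * (r ^ 2 * (z 1 + w * z 0))) (C + 1) := by
  have h := hC.of_exp_le (φ := fun z => θ * (r ^ 2 * (z 1 + w * z 0)))
    (Measurable.aemeasurable (by fun_prop)) (a := r) (b := 1) hr.1.le (by
      filter_upwards [hμ] with z hz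
      refine le_trans (Real.exp_le_exp.2 ?_) (exp_mul_le_of_mem_Icc ⟨hr.1.le, hr.2.le⟩ _)
      rw [hz.2, zero_add]
      have := mul_le_mul_of_nonneg_right hw (mul_nonneg (sq_nonneg r) (hz.1 0))
      linarith)
  rwa [mul_div_cancel₀ _ hr.1.ne'] at h

/-- Uniform exponential moments of `r² (z 1 + w z 0)` in the interior, for the weight `w`
making the face `z 0 = 0` invisible. -/
lemma BARFamily.expMoment_second_direction (hR : IsPMatrix R) (h : BARFamily Γ R π ν)
    {θ₀ C : ℝ} {S : Set ℝ} (hS : S ⊆ Set.Ioo 0 1)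
    (hC : ∀ r ∈ S, ExpMomentLE (ν 1 r) (fun z => θ₀ * (r * z 0)) (C / r))
    {θ w : ℝ} (hw : R 0 0 * w + R 1 0 = 0) (hθ : 0 < θ) (hθw : θ * w ≤ θ₀)
    (hθQ : θ * |Γ 0 0 * w ^ 2 + (Γ 0 1 + Γ 1 0) * w + Γ 1 1| ≤ R 0 1 * w + R 1 1) :
    ∀ r ∈ S, ExpMomentLE (π r) (fun z => θ * (r ^ 2 * (z 1 + w * z 0))) (2 * (C + 1)) := by
  obtain ⟨h00, h11, hdet⟩ := hR.entries_pos
  have hδ : 0 < R 0 1 * w + R 1 1 := by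
    have : R 0 0 * (R 0 1 * w + R 1 1) = R 0 0 * R 1 1 - R 0 1 * R 1 0 := by
      linear_combination R 0 1 * hw
    exact pos_of_mul_pos_right (this ▸ hdet) h00.le
  intro r hrS
  have hr := hS hrS
  obtain ⟨_, _, hπ, hν, hBAR⟩ := h.ae_mem hr
  have hν1 := expMoment_face_one (hν 1) hr hθw (hC r hrS)
  refine expMomentLE_of_integral_truncExp'_le (by fun_prop) fun ε hε => ?_
  have hmain := hBAR.linear_inequality hr.1 hπ hν w hθ hε
  rw [hw, zero_mul, zero_add, zero_add] at hmain
  have hI := integral_truncExp'_nonneg (μ := π r) (θ := θ) hε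
        fun z => r ^ 2 * (z 1 + w * z 0)
  have h1 := mul_le_mul_of_nonneg_left (hν1.integral_truncExp'_le hε)
    (mul_nonneg hr.1.le hδ.le)
  have h2 := mul_le_mul_of_nonneg_right (mul_le_mul_of_nonneg_left
    (by linarith : (R 0 1 * w + R 1 1) / 2 ≤ R 0 1 * w + R 1 1 -
      θ * |Γ 0 0 * w ^ 2 + (Γ 0 1 + Γ 1 0) * w + Γ 1 1| / 2) hr.1.le) hI
  refine le_of_mul_le_mul_left ?_ (mul_pos hr.1 hδ)
  linarith

lemma ExpMomentLE.change_direction {μ : Measure (Fin 2 → ℝ)} [IsProbabilityMeasure μ]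
    (hμ : ∀ᵐ z ∂μ, z ∈ posOrthant 2) {r θ θ₀ w v C₁ C₂ : ℝ} (hr : r ∈ Set.Ioo (0 : ℝ) 1)
    (h₁ : ExpMomentLE μ (fun z => θ₀ * (r * z 0)) C₁)
    (h₂ : ExpMomentLE μ (fun z => θ * (r ^ 2 * (z 1 + w * z 0))) C₂)
    (hθ₀ : 0 < θ₀) (hv : θ * (v - w) ≤ θ₀) :
    ExpMomentLE μ (fun z => θ / 2 * (r ^ 2 * (z 1 + v * z 0))) (C₁ + C₂) := by
  have hi := h₁.1.add h₂.1
  have hle : ∀ᵐ z ∂μ, Real.exp (θ / 2 * (r ^ 2 * (z 1 + v * z 0))) ≤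
      Real.exp (θ₀ * (r * z 0)) + Real.exp (θ * (r ^ 2 * (z 1 + w * z 0))) := by
    filter_upwards [hμ] with z hz
    have h0 := hz 0
    have hrr : r ^ 2 * z 0 ≤ r * z 0 := by
      refine mul_le_mul_of_nonneg_right ?_ h0
      nlinarith [hr.1, hr.2]
    have key : θ / 2 * (r ^ 2 * (z 1 + v * z 0)) ≤
        max (θ₀ * (r * z 0)) (θ * (r ^ 2 * (z 1 + w * z 0))) := by
      have h3 := mul_le_mul_of_nonneg_right hv (mul_nonneg (sq_nonneg r) h0)
      have h4 := mul_le_mul_of_nonneg_left hrr hθ₀.le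
      have h5 := le_max_left (θ₀ * (r * z 0)) (θ * (r ^ 2 * (z 1 + w * z 0)))
      have h6 := le_max_right (θ₀ * (r * z 0)) (θ * (r ^ 2 * (z 1 + w * z 0)))
      linarith
    have p1 := Real.exp_pos (θ₀ * (r * z 0))
    have p2 := Real.exp_pos (θ * (r ^ 2 * (z 1 + w * z 0)))
    rcases le_max_iff.1 key with hk | hk
    · linarith [Real.exp_le_exp.2 hk]
    · linarith [Real.exp_le_exp.2 hk]
  have hi' : Integrable (fun z => Real.exp (θ / 2 * (r ^ 2 * (z 1 + v * z 0)))) μ :=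
    hi.mono' (Measurable.aestronglyMeasurable (by fun_prop))
      (hle.mono fun z hz => by rwa [Real.norm_eq_abs, Real.abs_exp])
  refine ⟨hi', (integral_mono_ae hi' hi hle).trans ?_⟩
  rw [integral_add' h₁.1 h₂.1]
  exact add_le_add h₁.2 h₂.2

/-- Uniform exponential moments of `r² z 1`, in the interior and on the face `z 0 = 0`. -/
lemma BARFamily.expMoment_second (hR : IsPMatrix R) (h : BARFamily Γ R π ν)
    {θ₀ C₁ C₂ : ℝ} (hθ₀ : 0 < θ₀) {S : Set ℝ} (hS : S ⊆ Set.Ioo 0 1)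
    (hC₁ : ∀ r ∈ S, ExpMomentLE (π r) (fun z => θ₀ * (r * z 0)) C₁)
    (hC₂ : ∀ r ∈ S, ExpMomentLE (ν 1 r) (fun z => θ₀ * (r * z 0)) (C₂ / r)) :
    ∃ θ > 0, ∃ C, ∀ r ∈ S, ExpMomentLE (π r) (fun z => θ * (r ^ 2 * z 1)) C ∧
      ExpMomentLE (ν 0 r) (fun z => θ * (r ^ 2 * z 1)) C := by
  obtain ⟨h00, h11, hdet⟩ := hR.entries_pos
  obtain ⟨w, hw⟩ : ∃ w, w = -R 1 0 / R 0 0 := ⟨_, rfl⟩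
  have hw' : R 0 0 * w + R 1 0 = 0 := by rw [hw]; field_simp; ring
  obtain ⟨v, hv⟩ : ∃ v, v = w - 1 / R 0 0 := ⟨_, rfl⟩
  have hv' : R 0 0 * v + R 1 0 = -1 := by
    have : R 0 0 * v = R 0 0 * w - 1 := by rw [hv]; field_simp
    linarith
  have hδ : 0 < R 0 1 * w + R 1 1 := by
    have : R 0 0 * (R 0 1 * w + R 1 1) = R 0 0 * R 1 1 - R 0 1 * R 1 0 := by
      linear_combination R 0 1 * hw'
    exact pos_of_mul_pos_right (this ▸ hdet) h00.le
  obtain ⟨θ, hθ, hθQ, hθw⟩ : ∃ θ > 0,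
      θ * |Γ 0 0 * w ^ 2 + (Γ 0 1 + Γ 1 0) * w + Γ 1 1| ≤ R 0 1 * w + R 1 1 ∧
      θ * (|w| + |v|) ≤ θ₀ := by
    have small : ∀ A B : ℝ, 0 ≤ A → 0 < B → ∀ t, 0 ≤ t → t ≤ B / (A + 1) → t * A ≤ B := by
      intro A B hA hB t ht htB
      rw [le_div_iff₀ (by positivity)] at htB
      linarith
    refine ⟨min ((R 0 1 * w + R 1 1) /
        (|Γ 0 0 * w ^ 2 + (Γ 0 1 + Γ 1 0) * w + Γ 1 1| + 1)) (θ₀ / (|w| + |v| + 1)),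
      lt_min (by positivity) (by positivity),
      small _ _ (abs_nonneg _) hδ _ (le_min (by positivity) (by positivity)) (min_le_left _ _),
      small _ _ (by positivity) hθ₀ _ (le_min (by positivity) (by positivity))
        (min_le_right _ _)⟩
  have hbd : ∀ x, x ≤ |w| + |v| → θ * x ≤ θ₀ := fun x hx =>
    (mul_le_mul_of_nonneg_left hx hθ.le).trans hθw
  have hdir := h.expMoment_second_direction hR hS hC₂ hw' hθ
    (hbd w (by linarith [le_abs_self w, abs_nonneg v])) hθQ
  obtain ⟨B, hB⟩ : ∃ B, B = R 0 1 * v + R 1 1 := ⟨_, rfl⟩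
  obtain ⟨Q, hQ⟩ : ∃ Q, Q = |Γ 0 0 * v ^ 2 + (Γ 0 1 + Γ 1 0) * v + Γ 1 1| := ⟨_, rfl⟩
  have hQ0 : 0 ≤ Q := hQ ▸ abs_nonneg _
  refine ⟨θ / 2, by positivity, max (C₁ + 2 * (C₂ + 1))
    ((1 + |B| + θ / 2 * Q / 2) * (C₁ + 2 * (C₂ + 1)) + |B| * (C₂ + 1)), fun r hrS => ?_⟩
  have hr := hS hrS
  obtain ⟨_, _, hπ, hν, hBAR⟩ := h.ae_mem hr
  constructor
  · have h1 := ExpMomentLE.change_direction hπ hr (hC₁ r hrS) (hdir r hrS) hθ₀ (v := 0)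
      (hbd _ (by linarith [neg_le_abs w, abs_nonneg v]))
    simp only [zero_mul, add_zero] at h1
    exact ⟨h1.1, h1.2.trans (le_max_left _ _)⟩
  · have hWπ := ExpMomentLE.change_direction hπ hr (hC₁ r hrS) (hdir r hrS) hθ₀ (v := v)
      (hbd _ (by linarith [neg_le_abs w, le_abs_self v]))
    have hWν := expMoment_face_one (θ := θ / 2) (w := v) (hν 1) hr
      (by
        have h1 := hbd |v| (by linarith [abs_nonneg w])
        have h2 := mul_le_mul_of_nonneg_left (le_abs_self v) (by positivity : 0 ≤ θ / 2)
        have h3 := mul_nonneg hθ.le (abs_nonneg v)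
        linarith) (hC₂ r hrS)
    have hW : ExpMomentLE (ν 0 r) (fun z => θ / 2 * (r ^ 2 * (z 1 + v * z 0)))
        ((1 + |B| + θ / 2 * Q / 2) * (C₁ + 2 * (C₂ + 1)) + |B| * (C₂ + 1)) := by
      refine expMomentLE_of_integral_truncExp'_le (by fun_prop) fun ε hε => ?_
      have hmain := hBAR.linear_inequality hr.1 hπ hν v (half_pos hθ) hε
      rw [hv', ← hB, ← hQ] at hmain
      have hIπ := integral_truncExp'_nonneg (μ := π r) (θ := θ / 2) hε
        fun z => r ^ 2 * (z 1 + v * z 0)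
      have hIν := integral_truncExp'_nonneg (μ := ν 1 r) (θ := θ / 2) hε
        fun z => r ^ 2 * (z 1 + v * z 0)
      have hLπ := hWπ.integral_truncExp'_le hε
      have hLν := hWν.integral_truncExp'_le hε
      have hrB : |r * B| ≤ |B| := by
        rw [abs_mul, abs_of_pos hr.1]
        exact mul_le_of_le_one_left (abs_nonneg _) hr.2.le
      have hrQ : r * (θ / 2 * Q / 2) ≤ θ / 2 * Q / 2 :=
        mul_le_of_le_one_left (by positivity) hr.2.le
      have e1 := mul_le_mul_of_nonneg_right
        (by linarith [(abs_le.1 hrB).1, (abs_le.1 hrB).2] :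
          1 - r * (B - θ / 2 * Q / 2) ≤ 1 + |B| + θ / 2 * Q / 2) hIπ
      have e2 := mul_le_mul_of_nonneg_left hLπ
        (by positivity : 0 ≤ 1 + |B| + θ / 2 * Q / 2)
      have e3 := mul_le_mul_of_nonneg_right ((le_abs_self _).trans hrB) hIν
      have e4 := mul_le_mul_of_nonneg_left hLν (abs_nonneg B)
      linarith
    have h1 := hW.of_exp_le (φ := fun z => θ / 2 * (r ^ 2 * z 1))
      (Measurable.aemeasurable (by fun_prop))
      (a := 1) (b := 0) zero_le_one (by
        filter_upwards [hν 0] with z hz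
        simp [hz.2])
    rw [one_mul, add_zero] at h1
    exact ⟨h1.1, h1.2.trans (le_max_right _ _)⟩

lemma integral_pow_face_le_one {μ : Measure (Fin 2 → ℝ)} [IsProbabilityMeasure μ] {k : Fin 2}
    (hμ : ∀ᵐ z ∂μ, z ∈ posOrthant 2 ∧ z k = 0) (s : ℝ) (n : ℕ) :
    ∫ z, (s * z k) ^ n ∂μ ≤ 1 := by
  have h : ∫ z, (s * z k) ^ n ∂μ = ∫ _, (0 : ℝ) ^ n ∂μ :=
    integral_congr_ae (hμ.mono fun z hz => by simp [hz.2])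
  rw [h]
  simp only [integral_const, probReal_univ, one_smul]
  exact pow_le_one₀ le_rfl zero_le_one

lemma ExpMomentLE.mul_integral_sq_le {μ : Measure (Fin 2 → ℝ)} [IsProbabilityMeasure μ]
    {r θ C : ℝ} (hr : 0 < r) (hθ : 0 < θ) {φ : (Fin 2 → ℝ) → ℝ} (hφ : ∀ᵐ z ∂μ, 0 ≤ φ z)
    (h : ExpMomentLE μ (fun z => θ * φ z) (C / r)) :
    r * ∫ z, φ z ^ 2 ∂μ ≤ √r * (24 / θ ^ 4 * C + 1) := by
  have hs : 0 < √r := Real.sqrt_pos.2 hr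
  have hss : √r * √r = r := Real.mul_self_sqrt hr.le
  have hi : Integrable (fun z => √r * (24 / θ ^ 4) * Real.exp (θ * φ z) + 1 / √r) μ :=
    (h.1.const_mul _).add (integrable_const _)
  have hle : ∫ z, φ z ^ 2 ∂μ ≤ ∫ z, √r * (24 / θ ^ 4) * Real.exp (θ * φ z) + 1 / √r ∂μ := by
    refine integral_mono_of_nonneg (ae_of_all _ fun z => sq_nonneg _) hi
      (hφ.mono fun z hz => ?_)
    have h4 := Real.pow_div_factorial_le_exp (θ * φ z) (by positivity) 4
    have h4' : φ z ^ 4 ≤ 24 / θ ^ 4 * Real.exp (θ * φ z) := by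
      rw [div_mul_eq_mul_div, le_div_iff₀ (by positivity)]
      norm_num [Nat.factorial] at h4
      rw [div_le_iff₀ (by norm_num), mul_pow] at h4
      linarith
    have h5 := mul_le_mul_of_nonneg_left h4' hs.le
    have h6 : φ z ^ 2 ≤ √r * φ z ^ 4 + 1 / √r := by
      refine le_of_mul_le_mul_left ?_ hs
      have : √r * (√r * φ z ^ 4 + 1 / √r) = (√r * φ z ^ 2) ^ 2 + 1 := by field_simp
      rw [this]
      nlinarith [sq_nonneg (√r * φ z ^ 2 - 1)]
    simp only
    linarith
  have heq : ∫ z, √r * (24 / θ ^ 4) * Real.exp (θ * φ z) + 1 / √r ∂μ =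
      √r * (24 / θ ^ 4) * ∫ z, Real.exp (θ * φ z) ∂μ + 1 / √r := by
    rw [integral_add (h.1.const_mul _) (integrable_const _), integral_const_mul]
    simp
  have h2 := mul_le_mul_of_nonneg_left h.2 (by positivity : 0 ≤ √r * (24 / θ ^ 4))
  calc r * ∫ z, φ z ^ 2 ∂μ ≤ r * (√r * (24 / θ ^ 4) * (C / r) + 1 / √r) :=
        mul_le_mul_of_nonneg_left (by linarith) hr.le
    _ = √r * (24 / θ ^ 4 * C + 1) := by
        have : r * (1 / √r) = √r := by
          rw [mul_one_div, div_eq_iff hs.ne']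
          exact hss.symm
        rw [mul_add, this]
        field_simp

end Family

/-- Uniform moment bounds for a two-dimensional P-reflection matrix,
with the explicit threshold `r₀ = min{1, R₁₁/(2|R₁₂|)}` (and `r₀ = 1` if `R₁₂ = 0`);
in particular the uniform moment bound condition holds. -/
theorem uniform_moment_bounds_two_dim
    (Γ R : Matrix (Fin 2) (Fin 2) ℝ)
    (hΓsymm : Γ.IsSymm) (hΓpd : Γ.PosDef)
    (hR : IsPMatrix R)
    (π : ℝ → Measure (Fin 2 → ℝ)) (ν : Fin 2 → ℝ → Measure (Fin 2 → ℝ))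
    (hBAR : BARFamily Γ R π ν) :
    (∀ k : Fin 2, ∀ n : ℕ,
      ∃ C : ℝ, ∃ Cb : Fin 2 → ℝ,
        ∀ r ∈ Set.Ioo (0 : ℝ)
            (if R 0 1 = 0 then 1 else min 1 (R 0 0 / (2 * |R 0 1|))),
          (∫ z, (r ^ ((k : ℕ) + 1) * z k) ^ n ∂(π r)) < C ∧
          ∀ i : Fin 2,
            r ^ (i : ℕ) * (∫ z, (r ^ ((k : ℕ) + 1) * z k) ^ n ∂(ν i r)) < Cb i) ∧
    UniformMomentBound π ν := by
  obtain ⟨h00, -, -⟩ := hR.entries_pos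
  obtain ⟨r₀, hr₀⟩ : ∃ r₀ : ℝ,
      r₀ = if R 0 1 = 0 then 1 else min 1 (R 0 0 / (2 * |R 0 1|)) := ⟨_, rfl⟩
  have hr₀pos : 0 < r₀ := by
    rw [hr₀]
    split_ifs with h0
    · exact one_pos
    · have := abs_pos.2 h0
      exact lt_min one_pos (by positivity)
  have hr₀one : r₀ ≤ 1 := by
    rw [hr₀]
    split_ifs
    · exact le_rfl
    · exact min_le_left _ _
  have hS : Set.Ioo 0 r₀ ⊆ Set.Ioo (0 : ℝ) 1 := Set.Ioo_subset_Ioo_right hr₀one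
  have hsmall : ∀ r ∈ Set.Ioo 0 r₀, r * |R 0 1| ≤ R 0 0 / 2 := by
    intro r hr
    by_cases h0 : R 0 1 = 0
    · rw [h0, abs_zero, mul_zero]
      exact (half_pos h00).le
    · have := abs_pos.2 h0
      rw [if_neg h0] at hr₀
      have h1 : r ≤ R 0 0 / (2 * |R 0 1|) := hr.2.le.trans (hr₀ ▸ min_le_right _ _)
      rw [le_div_iff₀ (by positivity)] at h1
      linarith
  obtain ⟨θ₁, hθ₁, C₁, hC₁'⟩ := hBAR.expMoment_first_interior hR
  have hC₁ := fun r hr => hC₁' r (hS hr) (hsmall r hr)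
  obtain ⟨C₂, hC₂⟩ := hBAR.expMoment_first_boundary hR hθ₁ hS hC₁
  obtain ⟨θ₂, hθ₂, C₃, hC₃⟩ := hBAR.expMoment_second hR hθ₁ hS hC₁ hC₂
  have hmom : ∀ k : Fin 2, ∀ n : ℕ, ∃ C : ℝ, ∃ Cb : Fin 2 → ℝ, ∀ r ∈ Set.Ioo (0 : ℝ) r₀,
      (∫ z, (r ^ ((k : ℕ) + 1) * z k) ^ n ∂(π r)) < C ∧
      ∀ i : Fin 2, r ^ (i : ℕ) * (∫ z, (r ^ ((k : ℕ) + 1) * z k) ^ n ∂(ν i r)) < Cb i := by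
    intro k n
    fin_cases k
    · refine ⟨n.factorial / θ₁ ^ n * C₁ + 1, ![2, n.factorial / θ₁ ^ n * C₂ + 1],
        fun r hr => ?_⟩
      obtain ⟨_, _, hπ, hν, -⟩ := hBAR.ae_mem (hS hr)
      have h1 := (hC₁ r hr).integral_pow_le hθ₁
        (hπ.mono fun z hz => mul_nonneg hr.1.le (hz 0)) n
      have h2 := (hC₂ r hr).integral_pow_le hθ₁
        ((hν 1).mono fun z hz => mul_nonneg hr.1.le (hz.1 0)) n
      have h3 := integral_pow_face_le_one (hν 0) r n
      have h2' := mul_le_mul_of_nonneg_left h2 hr.1.le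
      have h4 : r * (n.factorial / θ₁ ^ n * (C₂ / r)) = n.factorial / θ₁ ^ n * C₂ := by
        have := hr.1.ne'
        field_simp
      refine ⟨?_, fun i => ?_⟩
      · simp only [Fin.zero_eta, zero_add, pow_one]
        linarith
      · fin_cases i
        · simp only [Fin.zero_eta, zero_add, pow_one, pow_zero, one_mul,
            Matrix.cons_val_zero]
          linarith
        · simp only [Fin.zero_eta, Fin.mk_one, zero_add, pow_one,
            Matrix.cons_val_one, Matrix.cons_val_fin_one]
          linarith
    · refine ⟨n.factorial / θ₂ ^ n * C₃ + 1, ![n.factorial / θ₂ ^ n * C₃ + 1, 2],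
        fun r hr => ?_⟩
      obtain ⟨_, _, hπ, hν, -⟩ := hBAR.ae_mem (hS hr)
      have h1 := (hC₃ r hr).1.integral_pow_le hθ₂
        (hπ.mono fun z hz => mul_nonneg (sq_nonneg r) (hz 1)) n
      have h2 := (hC₃ r hr).2.integral_pow_le hθ₂
        ((hν 0).mono fun z hz => mul_nonneg (sq_nonneg r) (hz.1 1)) n
      have h3 := mul_le_mul_of_nonneg_left (integral_pow_face_le_one (hν 1) (r ^ 2) n) hr.1.le
      have h4 := (hS hr).2
      refine ⟨?_, fun i => ?_⟩
      · simp only [Fin.mk_one, one_add_one_eq_two]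
        linarith
      · fin_cases i
        · simp only [Fin.zero_eta, Fin.mk_one, one_add_one_eq_two,
            pow_zero, one_mul, Matrix.cons_val_zero]
          linarith
        · simp only [Fin.mk_one, one_add_one_eq_two, pow_one,
            Matrix.cons_val_one, Matrix.cons_val_fin_one]
          linarith
  refine ⟨hr₀ ▸ hmom, fun i k => ⟨?_, ?_⟩⟩
  · obtain ⟨C, _, hC⟩ := hmom k 2
    exact ⟨r₀, hr₀pos, C, fun r hr => (hC r ⟨hr.1, hr.2.trans_le (min_le_left _ _)⟩).1.le⟩
  · obtain ⟨K, hK⟩ : ∃ K : ℝ, ∀ r ∈ Set.Ioo 0 r₀,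
        r * ∫ z, (r ^ ((k : ℕ) + 1) * z k) ^ 2 ∂(ν i r) ≤ √r * K := by
      have hbdd : ∀ K : ℝ, (∀ r ∈ Set.Ioo 0 r₀,
          ∫ z, (r ^ ((k : ℕ) + 1) * z k) ^ 2 ∂(ν i r) ≤ K) → ∀ r ∈ Set.Ioo 0 r₀,
          r * ∫ z, (r ^ ((k : ℕ) + 1) * z k) ^ 2 ∂(ν i r) ≤ √r * K := by
        intro K hK r hr
        have hI : 0 ≤ ∫ z, (r ^ ((k : ℕ) + 1) * z k) ^ 2 ∂(ν i r) :=
          integral_nonneg fun z => sq_nonneg _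
        refine mul_le_mul (Real.le_sqrt_of_sq_le ?_) (hK r hr) hI (Real.sqrt_nonneg r)
        nlinarith [hr.1, (hS hr).2]
      fin_cases i
      · obtain ⟨_, Cb, hC⟩ := hmom k 2
        exact ⟨Cb 0, hbdd _ fun r hr => by simpa using ((hC r hr).2 0).le⟩
      · fin_cases k
        · refine ⟨24 / θ₁ ^ 4 * C₂ + 1, fun r hr => ?_⟩
          obtain ⟨_, _, -, hν, -⟩ := hBAR.ae_mem (hS hr)
          have h1 := (hC₂ r hr).mul_integral_sq_le hr.1 hθ₁
            ((hν 1).mono fun z hz => mul_nonneg hr.1.le (hz.1 0))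
          simpa using h1
        · refine ⟨1, hbdd _ fun r hr => ?_⟩
          obtain ⟨_, _, -, hν, -⟩ := hBAR.ae_mem (hS hr)
          exact integral_pow_face_le_one (hν 1) _ 2
    have hlim : Tendsto (fun r : ℝ => √r * K) (nhdsWithin 0 (Set.Ioo 0 1)) (nhds 0) := by
      have : Tendsto (fun r : ℝ => √r * K) (nhds 0) (nhds (√0 * K)) :=
        (Real.continuous_sqrt.mul continuous_const).tendsto 0
      rw [Real.sqrt_zero, zero_mul] at this
      exact this.mono_left nhdsWithin_le_nhds
    have hev : ∀ᶠ r in nhdsWithin (0 : ℝ) (Set.Ioo 0 1), r ∈ Set.Ioo 0 r₀ := by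
      filter_upwards [self_mem_nhdsWithin,
        mem_nhdsWithin_of_mem_nhds (Iio_mem_nhds hr₀pos)] with r hr hr'
      exact ⟨hr.1, hr'⟩
    refine squeeze_zero' (hev.mono fun r hr => ?_) (hev.mono hK) hlim
    exact mul_nonneg hr.1.le (integral_nonneg fun z => sq_nonneg _)

end SRBMPaper
end
end
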